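/- If ℵ₁^{L[a]} < ℵ₁ for every real a, then there are no infinite boldface Σ¹₂ maximal almost disjoint families. -/

import Mathlib

/-- Almost disjoint family of subsets of `ω`. -/
def AlmostDisjointFam (𝒜 : Set (Set ℕ)) : Prop :=
  ∀ x ∈ 𝒜, ∀ y ∈ 𝒜, x = y ∨ (x ∩ y).Finite

/-- `S ⊆ 2^ω` is (lightface) `Π¹₁(a)`, via the classical normal form: membership is
`∀ z ∈ ω^ω ∃ n R(x ↾ n, z ↾ n, a ↾ n)` for a computable predicate `R` on finite
sequences. -/
def Pi11In (a : ℕ → ℕ) (S : Set (ℕ → Bool)) : Prop :=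
  ∃ R : List Bool × List ℕ × List ℕ → Bool, Computable R ∧
    S = {x | ∀ z : ℕ → ℕ, ∃ n : ℕ,
      R (List.ofFn fun i : Fin n => x i, List.ofFn fun i : Fin n => z i,
         List.ofFn fun i : Fin n => a i) = true}

/-- A family `𝒜` of subsets of `ω` is (lightface) `Σ¹₂(a)`, via the classical normal
form `∃ y ∈ ω^ω ∀ z ∈ ω^ω ∃ n R(x ↾ n, y ↾ n, z ↾ n, a ↾ n)` with `R` computable. -/
def Sigma12In (a : ℕ → ℕ) (𝒜 : Set (Set ℕ)) : Prop :=
  ∃ R : List Bool × List ℕ × List ℕ × List ℕ → Bool, Computable R ∧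
    𝒜 = {A | ∃ x : ℕ → Bool, {n | x n = true} = A ∧
      ∃ y : ℕ → ℕ, ∀ z : ℕ → ℕ, ∃ n : ℕ,
        R (List.ofFn fun i : Fin n => x i, List.ofFn fun i : Fin n => y i,
           List.ofFn fun i : Fin n => z i, List.ofFn fun i : Fin n => a i) = true}

/-- The classical Solovay–Mansfield equivalent of `ℵ₁^{L[a]} < ℵ₁`: every `Π¹₁(a)`
subset of Cantor space is countable or contains a nonempty perfect set. -/
def Aleph1OfLaCountable (a : ℕ → ℕ) : Prop :=
  ∀ S : Set (ℕ → Bool), Pi11In a S →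
    S.Countable ∨ ∃ C ⊆ S, Perfect C ∧ C.Nonempty

section

open Set Filter Topology MeasureTheory

/-- The restriction of a sequence to its first `n` terms, as a list. -/
def seqRestrict {α : Type*} (x : ℕ → α) (n : ℕ) : List α := (List.range n).map x

theorem ofFn_eq_seqRestrict {α : Type*} (x : ℕ → α) (n : ℕ) :
    (List.ofFn fun i : Fin n => x i) = seqRestrict x n := by
  apply List.ext_getElem <;> simp [seqRestrict]

@[simp] theorem length_seqRestrict {α : Type*} (x : ℕ → α) (n : ℕ) :
    (seqRestrict x n).length = n := by simp [seqRestrict]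

theorem take_seqRestrict {α : Type*} (x : ℕ → α) {m n : ℕ} (h : m ≤ n) :
    (seqRestrict x n).take m = seqRestrict x m := by
  apply List.ext_getElem <;> simp [seqRestrict, h]

theorem getElem?_seqRestrict {α : Type*} (x : ℕ → α) {m n : ℕ} (h : m < n) :
    (seqRestrict x n)[m]? = some (x m) := by
  simp [seqRestrict, h]

theorem seqRestrict_eq_iff {α : Type*} (x y : ℕ → α) (n : ℕ) :
    seqRestrict x n = seqRestrict y n ↔ ∀ i < n, x i = y i := by
  simp [seqRestrict]

theorem tendsto_of_forall_lt_eq {α : Type*} [TopologicalSpace α] {x : ℕ → α} {y : ℕ → ℕ → α}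
    (h : ∀ n, ∀ i < n, y n i = x i) : Tendsto y atTop (𝓝 x) := by
  rw [tendsto_pi_nhds]
  intro i
  apply tendsto_const_nhds.congr'
  filter_upwards [eventually_gt_atTop i] with n hn
  exact (h n i hn).symm

/-- A set with analytic complement has a tree-like normal form. -/
theorem exists_normal_form {α : Type*} [TopologicalSpace α] [T2Space α] (S : Set (ℕ → α))
    (hS : AnalyticSet Sᶜ) :
    ∃ J : List α → List ℕ → Prop,
      S = {x | ∀ z : ℕ → ℕ, ∃ n, ¬ J (seqRestrict x n) (seqRestrict z n)} := by
  rw [AnalyticSet] at hS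
  rcases hS with h | ⟨f, hf, hr⟩
  · refine ⟨fun _ _ => False, ?_⟩
    have : S = univ := by simpa using h
    rw [this]; ext; simp
  · refine ⟨fun s σ => ∃ z', σ = seqRestrict z' σ.length ∧ s = seqRestrict (f z') σ.length, ?_⟩
    ext x
    simp only [mem_ofPred_eq]
    constructor
    · intro hx z
      by_contra! hcon
      choose z' h1 h2 using hcon
      simp only [length_seqRestrict, seqRestrict_eq_iff] at h1 h2
      have t1 : Tendsto z' atTop (𝓝 z) := tendsto_of_forall_lt_eq fun n i hi => (h1 n i hi).symm
      have t2 : Tendsto (fun n => f (z' n)) atTop (𝓝 x) :=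
        tendsto_of_forall_lt_eq fun n i hi => (h2 n i hi).symm
      have t3 := (hf.tendsto z).comp t1
      have : f z = x := tendsto_nhds_unique t3 t2
      have h' : x ∈ Sᶜ := hr ▸ ⟨z, this⟩
      exact h' hx
    · intro h
      by_contra hx
      have h' : x ∈ range f := hr ▸ hx
      obtain ⟨z, rfl⟩ := h'
      obtain ⟨n, hn⟩ := h z
      exact hn ⟨z, by simp, by simp⟩

/-- Universal verifier: looks up the answer for a short initial segment in the parameter. -/
def lookupVerifier (p : List Bool × List ℕ × List ℕ) : Bool :=
  decide (p.2.2[Encodable.encode (p.1.take p.1.length.unpair.1,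
    p.2.1.take p.1.length.unpair.1)]? = some 1)

theorem computable_lookupVerifier : Computable lookupVerifier := by
  apply Primrec.to_comp
  have hm : Primrec fun p : List Bool × List ℕ × List ℕ => p.1.length.unpair.1 :=
    Primrec.fst.comp (Primrec.unpair.comp (Primrec.list_length.comp Primrec.fst))
  have h1 : Primrec fun p : List Bool × List ℕ × List ℕ =>
      Encodable.encode (p.1.take p.1.length.unpair.1, p.2.1.take p.1.length.unpair.1) :=
    Primrec.encode.comp (Primrec.pair (Primrec.list_take.comp hm Primrec.fst)
      (Primrec.list_take.comp hm (Primrec.fst.comp Primrec.snd)))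
  have h2 := Primrec.list_getElem?.comp (Primrec.snd.comp Primrec.snd) h1
  exact (Primrec.eq.comp h2 (Primrec.const (some 1))).decide

theorem exists_pi11In (S : Set (ℕ → Bool)) (hS : AnalyticSet Sᶜ) : ∃ a, Pi11In a S := by
  classical
  obtain ⟨J, rfl⟩ := exists_normal_form S hS
  let a : ℕ → ℕ := fun k => match Encodable.decode (α := List Bool × List ℕ) k with
    | some q => if J q.1 q.2 then 0 else 1
    | none => 0
  have ha : ∀ q : List Bool × List ℕ, a (Encodable.encode q) = 1 ↔ ¬ J q.1 q.2 := by
    intro q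
    change (match Encodable.decode (α := List Bool × List ℕ) (Encodable.encode q) with
      | some q => if J q.1 q.2 then 0 else 1
      | none => 0) = 1 ↔ _
    rw [Encodable.encodek]
    simp
  refine ⟨a, lookupVerifier, computable_lookupVerifier, ?_⟩
  ext x
  simp only [mem_ofPred_eq, ofFn_eq_seqRestrict]
  refine forall_congr' fun z => ?_
  constructor
  · rintro ⟨m, hm⟩
    let q := (seqRestrict x m, seqRestrict z m)
    let n := Nat.pair m (Encodable.encode q + 1)
    have hn : Encodable.encode q < n := (Nat.lt_succ_self _).trans_le (Nat.right_le_pair m _)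
    refine ⟨n, ?_⟩
    have hmn : m ≤ n := Nat.left_le_pair _ _
    have hu : n.unpair.1 = m := by simp [n]
    simp only [lookupVerifier, length_seqRestrict, hu, take_seqRestrict _ hmn]
    rw [getElem?_seqRestrict _ hn]
    rw [decide_eq_true_iff]
    exact congrArg some ((ha q).2 hm)
  · rintro ⟨n, hn⟩
    have hmn : n.unpair.1 ≤ n := Nat.unpair_left_le n
    refine ⟨n.unpair.1, ?_⟩
    simp only [lookupVerifier, length_seqRestrict, take_seqRestrict _ hmn, decide_eq_true_iff] at hn
    have hlt : Encodable.encode (seqRestrict x n.unpair.1, seqRestrict z n.unpair.1) < n := by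
      by_contra! hge
      rw [List.getElem?_eq_none (by simpa using hge)] at hn
      simp at hn
    rw [getElem?_seqRestrict _ hlt] at hn
    exact (ha (_, _)).1 (Option.some.inj hn)

theorem not_countable_cantor : ¬ (univ : Set (ℕ → Bool)).Countable := by
  rw [countable_univ_iff]
  intro h
  have h1 := Cardinal.mk_le_aleph0_iff.2 h
  simp only [Cardinal.mk_pi, Cardinal.mk_bool, Cardinal.prod_const, Cardinal.mk_nat,
    Cardinal.lift_aleph0, Cardinal.lift_ofNat] at h1
  exact (Cardinal.cantor Cardinal.aleph0).not_ge h1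

/-- Analytic subsets of a measurable space: projections of measurable sets along Baire space. -/
def An {X : Type*} [MeasurableSpace X] (S : Set X) : Prop :=
  ∃ B : Set (X × (ℕ → ℕ)), MeasurableSet B ∧ S = {x | ∃ z, (x, z) ∈ B}

namespace An

variable {X Y : Type*} [MeasurableSpace X] [MeasurableSpace Y]

theorem of_measurableSet {S : Set X} (h : MeasurableSet S) : An S :=
  ⟨Prod.fst ⁻¹' S, measurable_fst h, by simp⟩

theorem iUnion {ι : Type*} [Countable ι] {S : ι → Set X} (h : ∀ i, An (S i)) :
    An (⋃ i, S i) := by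
  choose B hB hS using h
  refine ⟨⋃ i, B i, MeasurableSet.iUnion hB, ?_⟩
  ext x
  simp only [hS, mem_iUnion, mem_ofPred_eq]
  exact exists_comm

theorem iInter {ι : Type*} [Countable ι] {S : ι → Set X} (h : ∀ i, An (S i)) :
    An (⋂ i, S i) := by
  choose B hB hS using h
  obtain ⟨e, he⟩ := exists_injective_nat ι
  refine ⟨⋂ i, (fun p : X × (ℕ → ℕ) => (p.1, fun n => p.2 (Nat.pair (e i) n))) ⁻¹' B i,
    MeasurableSet.iInter fun i => ?_, ?_⟩
  · refine Measurable.prodMk measurable_fst (measurable_pi_lambda _ fun n => ?_) (hB i)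
    exact (measurable_pi_apply _).comp measurable_snd
  · ext x
    simp only [hS, mem_iInter, mem_ofPred_eq, mem_preimage]
    constructor
    · intro hx
      choose z hz using hx
      classical
      refine ⟨fun k => if h : ∃ i, e i = k.unpair.1 then z h.choose k.unpair.2 else 0,
        fun i => ?_⟩
      have h1 : ∃ j, e j = e i := ⟨i, rfl⟩
      have h2 : h1.choose = i := he h1.choose_spec
      convert hz i using 2
      funext n
      simp only [Nat.unpair_pair]
      rw [dif_pos h1, h2]
    · rintro ⟨z, hz⟩ i
      exact ⟨_, hz i⟩

theorem inter {S T : Set X} (hS : An S) (hT : An T) : An (S ∩ T) := by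
  rw [inter_eq_iInter]
  exact iInter (by rintro (_ | _) <;> assumption)

theorem union {S T : Set X} (hS : An S) (hT : An T) : An (S ∪ T) := by
  rw [union_eq_iUnion]
  exact iUnion (by rintro (_ | _) <;> assumption)

theorem preimage {S : Set Y} (hS : An S) {f : X → Y} (hf : Measurable f) : An (f ⁻¹' S) := by
  obtain ⟨B, hB, rfl⟩ := hS
  exact ⟨(fun p : X × (ℕ → ℕ) => (f p.1, p.2)) ⁻¹' B,
    ((hf.comp measurable_fst).prodMk measurable_snd) hB, by ext; simp⟩

theorem proj {S : Set (X × (ℕ → ℕ))} (hS : An S) : An {x | ∃ z, (x, z) ∈ S} := by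
  obtain ⟨B, hB, rfl⟩ := hS
  refine ⟨(fun p : X × (ℕ → ℕ) => ((p.1, fun n => p.2 (2 * n)), fun n => p.2 (2 * n + 1))) ⁻¹' B,
    Measurable.prodMk (Measurable.prodMk measurable_fst ?_) ?_ hB, ?_⟩
  · exact measurable_pi_lambda _ fun n => (measurable_pi_apply _).comp measurable_snd
  · exact measurable_pi_lambda _ fun n => (measurable_pi_apply _).comp measurable_snd
  · ext x
    simp only [mem_ofPred_eq, mem_preimage]
    constructor
    · rintro ⟨z, z', h⟩
      refine ⟨fun n => if n % 2 = 0 then z (n / 2) else z' (n / 2), ?_⟩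
      convert h using 3
      · funext n; simp
      · rename_i n
        have h1 : (2 * n + 1) % 2 = 1 := by omega
        have h2 : (2 * n + 1) / 2 = n := by omega
        simp [h1, h2]
    · rintro ⟨z, h⟩
      exact ⟨_, _, h⟩

/-- Projection along any measurable image of Baire space. -/
theorem proj_of_surjective {S : Set (X × Y)} (hS : An S) {g : (ℕ → ℕ) → Y} (hg : Measurable g)
    (hs : Function.Surjective g) : An {x | ∃ y, (x, y) ∈ S} := by
  have h := (hS.preimage (f := fun p : X × (ℕ → ℕ) => (p.1, g p.2))
    (measurable_fst.prodMk (hg.comp measurable_snd))).proj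
  convert h using 1
  ext x
  exact hs.exists

theorem analyticSet {X : Type*} [TopologicalSpace X] [PolishSpace X] [MeasurableSpace X]
    [BorelSpace X] {S : Set X} (hS : An S) : AnalyticSet S := by
  obtain ⟨B, hB, rfl⟩ := hS
  convert hB.analyticSet.image_of_continuous continuous_fst using 1
  ext x
  simp

theorem of_analyticSet {X : Type*} [TopologicalSpace X] [PolishSpace X] [MeasurableSpace X]
    [BorelSpace X] {S : Set X} (hS : AnalyticSet S) : An S := by
  rw [AnalyticSet] at hS
  rcases hS with rfl | ⟨f, hf, rfl⟩
  · exact of_measurableSet MeasurableSet.empty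
  · refine ⟨{p | f p.2 = p.1}, ?_, ?_⟩
    · exact measurableSet_eq_fun (hf.measurable.comp measurable_snd) measurable_fst
    · ext x; simp

end An

instance instPolishSpacePi {ι : Type*} [Countable ι] {E : ι → Type*} [∀ i, TopologicalSpace (E i)]
    [∀ i, PolishSpace (E i)] : PolishSpace (∀ i, E i) where
  toIsCompletelyMetrizableSpace := TopologicalSpace.IsCompletelyMetrizableSpace.pi_countable

/-- The perfect set property for coanalytic subsets of Cantor space. -/
def CoanalyticPSP : Prop :=
  ∀ S : Set (ℕ → Bool), An Sᶜ → S.Countable ∨ ∃ C ⊆ S, An C ∧ ¬ C.Countable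

theorem coanalyticPSP_of_small (hsmall : ∀ a : ℕ → ℕ, Aleph1OfLaCountable a) :
    CoanalyticPSP := by
  intro S hS
  obtain ⟨a, ha⟩ := exists_pi11In S hS.analyticSet
  refine (hsmall a S ha).imp_right ?_
  rintro ⟨C, hCS, hC, hne⟩
  let := TopologicalSpace.upgradeIsCompletelyMetrizable (ℕ → Bool)
  obtain ⟨f, hfC, hfc, hfi⟩ := hC.exists_nat_bool_injection hne
  refine ⟨range f, hfC.trans hCS, ?_, ?_⟩
  · exact An.of_analyticSet (analyticSet_range_of_polishSpace hfc)
  · intro h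
    apply not_countable_cantor
    rw [← image_univ] at h
    exact countable_of_injective_of_countable_image hfi.injOn h


/-- The perfect set property transfers to uncountable standard Borel spaces. -/
theorem CoanalyticPSP.standardBorel (H : CoanalyticPSP) {X : Type} [MeasurableSpace X]
    [StandardBorelSpace X] (S : Set X) (hS : An Sᶜ) :
    S.Countable ∨ ∃ C ⊆ S, An C ∧ ¬ C.Countable := by
  by_cases hX : Countable X
  · exact Or.inl S.to_countable
  have hB : ¬ Countable (ℕ → Bool) := fun h => not_countable_cantor countable_univ
  let e : X ≃ᵐ (ℕ → Bool) := PolishSpace.measurableEquivOfNotCountable hX hB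
  rcases H (e.symm ⁻¹' S) (hS.preimage e.symm.measurable) with h | ⟨C, hCS, hC, hCc⟩
  · left
    have := h.image e.symm
    rwa [image_preimage_eq _ e.symm.surjective] at this
  · right
    refine ⟨e ⁻¹' C, fun x hx => by simpa using hCS hx, hC.preimage e.measurable, ?_⟩
    intro h
    apply hCc
    have := h.image e
    rwa [image_preimage_eq _ e.surjective] at this

/-! ### Ranks and simulations -/

/-- The rank of `a` for the relation `r`, with value `0` outside the accessible part. -/
noncomputable def relRank {ι : Type} (r : ι → ι → Prop) (a : ι) : Ordinal.{0} :=
  open Classical in if h : Acc r a then h.rank else 0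

theorem relRank_lt_of_rel {ι : Type} {r : ι → ι → Prop} {a b : ι} (hb : Acc r b) (h : r a b) :
    relRank r a < relRank r b := by
  rw [relRank, relRank, dif_pos (hb.inv h), dif_pos hb]
  exact hb.rank_lt_of_rel h

theorem relRank_le {ι : Type} {r : ι → ι → Prop} {a : ι} (ha : Acc r a) {o : Ordinal.{0}}
    (h : ∀ b, r b a → relRank r b < o) : relRank r a ≤ o := by
  rw [relRank, dif_pos ha, ha.rank_eq]
  refine Ordinal.iSup_le fun ⟨b, hb⟩ => Order.succ_le_of_lt ?_
  have := h b hb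
  rwa [relRank, dif_pos (ha.inv hb)] at this

theorem exists_rel_of_lt_relRank {ι : Type} {r : ι → ι → Prop} {a : ι} (ha : Acc r a)
    {o : Ordinal.{0}} (h : o < relRank r a) : ∃ b, r b a ∧ o ≤ relRank r b := by
  by_contra! hcon
  exact (relRank_le ha hcon).not_gt h

theorem relRank_le_of_strictMono {ι : Type} {r : ι → ι → Prop} {a : ι} (ha : Acc r a)
    (f : ι → Ordinal.{0}) (hf : ∀ a b, r a b → f a < f b) : relRank r a ≤ f a := by
  induction ha with
  | intro a h ih =>
    exact relRank_le (Acc.intro a h) fun b hb => (ih b hb).trans_lt (hf b a hb)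

/-- Some simulation of `r` by `s` relates `a` to `b`. -/
def Simulates {ι : Type} (r : ι → ι → Prop) (a : ι) (s : ι → ι → Prop) (b : ι) : Prop :=
  ∃ G : ι → ι → Prop, G a b ∧ ∀ a b, G a b → ∀ a', r a' a → ∃ b', s b' b ∧ G a' b'

theorem Simulates.acc {ι : Type} {r s : ι → ι → Prop} {a b : ι} (h : Simulates r a s b)
    (hb : Acc s b) : Acc r a := by
  obtain ⟨G, hG, hs⟩ := h
  induction hb generalizing a with
  | intro b _ ih =>
    refine Acc.intro a fun a' ha' => ?_
    obtain ⟨b', hb', hG'⟩ := hs a b hG a' ha'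
    exact ih b' hb' hG'

theorem simulates_iff {ι : Type} {r s : ι → ι → Prop} {a b : ι} (ha : Acc r a) (hb : Acc s b) :
    Simulates r a s b ↔ relRank r a ≤ relRank s b := by
  constructor
  · rintro ⟨G, hG, hs⟩
    clear ha
    have hacc : ∀ a b, G a b → Acc s b → Acc r a := fun a b hab h =>
      Simulates.acc ⟨G, hab, hs⟩ h
    induction hb generalizing a with
    | intro b hb' ih =>
      refine relRank_le (hacc a b hG (Acc.intro b hb')) fun a' ha' => ?_
      obtain ⟨b', hb', hG'⟩ := hs a b hG a' ha'
      exact (ih b' hb' hG').trans_lt (relRank_lt_of_rel (Acc.intro b (by assumption)) hb')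
  · intro h
    refine ⟨fun a b => Acc r a ∧ Acc s b ∧ relRank r a ≤ relRank s b, ⟨ha, hb, h⟩, ?_⟩
    rintro a b ⟨ha, hb, h⟩ a' ha'
    obtain ⟨b', hb', h'⟩ := exists_rel_of_lt_relRank hb ((relRank_lt_of_rel ha ha').trans_le h)
    exact ⟨b', hb', ha.inv ha', hb.inv hb', h'⟩

/-! ### Lexicographically least elements -/

section Lex

variable {A : Set (ℕ → ℕ)} (κ : (ℕ → ℕ) → ℕ → Ordinal.{0})

/-- Elements minimizing the first `n` keys lexicographically. -/
def lexStage (A : Set (ℕ → ℕ)) (κ : (ℕ → ℕ) → ℕ → Ordinal.{0}) : ℕ → Set (ℕ → ℕ)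
  | 0 => A
  | n + 1 => {y | y ∈ lexStage A κ n ∧ ∀ y' ∈ lexStage A κ n, κ y n ≤ κ y' n}

theorem lexStage_subset (n : ℕ) : lexStage A κ (n + 1) ⊆ lexStage A κ n := fun _ h => h.1

theorem lexStage_antitone : Antitone (lexStage A κ) := antitone_nat_of_succ_le (lexStage_subset κ)

theorem lexStage_nonempty (hA : A.Nonempty) (n : ℕ) : (lexStage A κ n).Nonempty := by
  induction n with
  | zero => exact hA
  | succ n ih =>
    obtain ⟨o, ⟨y, hy, rfl⟩, h⟩ := WellFounded.has_min (Ordinal.lt_wf)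
      ((fun y => κ y n) '' lexStage A κ n) (ih.image _)
    exact ⟨y, hy, fun y' hy' => not_lt.1 (h _ ⟨y', hy', rfl⟩)⟩

theorem mem_lexStage_of_le {y y' : ℕ → ℕ} (hy : ∀ n, y ∈ lexStage A κ n) (hy' : y' ∈ A) (n : ℕ)
    (h : ∀ i < n, κ y' i ≤ κ y i) : y' ∈ lexStage A κ n := by
  induction n with
  | zero => exact hy'
  | succ n ih =>
    exact ⟨ih fun i hi => h i (by omega), fun z hz => (h n (by omega)).trans ((hy (n + 1)).2 z hz)⟩

theorem exists_lexStage_limit (hA : A.Nonempty) (hdig : ∀ y n, κ y (2 * n + 1) = y n) :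
    ∃ (y : ℕ → ℕ) (lam : ℕ → Ordinal.{0}), (∀ n, lam (2 * n + 1) = y n) ∧
      (∀ n, ∀ y' ∈ lexStage A κ n, lam n ≤ κ y' n) ∧
      ∀ n, ∃ y' ∈ A, (∀ i < n, κ y' i = lam i) ∧ ∀ i, 2 * i + 1 < n → y' i = y i := by
  choose z hz using fun n => lexStage_nonempty κ hA n
  have key : ∀ n, ∀ y' ∈ lexStage A κ (n + 1), κ y' n = κ (z (n + 1)) n := fun n y' hy' =>
    le_antisymm (hy'.2 _ (hz (n + 1)).1) ((hz (n + 1)).2 _ hy'.1)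
  have key' : ∀ i n, i < n → κ (z n) i = κ (z (i + 1)) i := fun i n hi =>
    key i _ (lexStage_antitone κ (by omega : i + 1 ≤ n) (hz n))
  refine ⟨fun n => z (2 * n + 2) n, fun n => κ (z (n + 1)) n, fun n => hdig _ _,
    fun n y' hy' => (hz (n + 1)).2 y' hy', fun n => ⟨z n, ?_, fun i hi => key' i n hi, ?_⟩⟩
  · exact lexStage_antitone κ (Nat.zero_le n) (hz n)
  · intro i hi
    have := key' _ _ hi
    rw [hdig, hdig] at this
    exact_mod_cast this

end Lex

/-! ### Trees attached to coanalytic sets -/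

theorem seqRestrict_succ {α : Type*} (x : ℕ → α) (n : ℕ) :
    seqRestrict x (n + 1) = seqRestrict x n ++ [x n] := by
  simp [seqRestrict, List.range_succ]

theorem measurable_seqRestrict_pred {X α : Type*} [MeasurableSpace X] [Countable α]
    [MeasurableSpace α] [MeasurableSingletonClass α] {g : X → ℕ → α}
    (hg : ∀ i, Measurable fun x => g x i) (Q : List α → Prop) (n : ℕ) :
    Measurable fun x => Q (seqRestrict (g x) n) := by
  have h : ∀ l : List α, Measurable fun x => seqRestrict (g x) n = l := by
    induction n with
    | zero =>
      intro l
      simp [seqRestrict]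
    | succ n ih =>
      intro l
      simp only [seqRestrict_succ]
      have h2 : (fun x => seqRestrict (g x) n ++ [g x n] = l) =
          fun x => ∃ p : List α × α, seqRestrict (g x) n = p.1 ∧ g x n = p.2 ∧ p.1 ++ [p.2] = l := by
        funext x
        simp
      rw [h2]
      refine Measurable.exists fun p => (ih p.1).and (Measurable.and ?_ measurable_const)
      exact measurableSet_setOfPred.1 (hg n (measurableSet_singleton p.2))
  have h2 : (fun x => Q (seqRestrict (g x) n)) =
      fun x => ∃ l, seqRestrict (g x) n = l ∧ Q l := by
    funext x
    simp
  rw [h2]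
  exact Measurable.exists fun l => (h l).and measurable_const

section Tree

variable {α : Type} (J : List α → List ℕ → Prop)

/-- The child relation of the tree of attempts to follow `J` along `p`. -/
def treeRel (p : ℕ → α) (τ σ : List ℕ) : Prop :=
  (∃ k, τ = σ ++ [k]) ∧ ∀ n ≤ τ.length, J (seqRestrict p n) (τ.take n)

variable {J}

theorem treeRel_congr {p q : ℕ → α} {τ σ : List ℕ} (h : ∀ i < τ.length, p i = q i) :
    treeRel J p τ σ ↔ treeRel J q τ σ := by
  refine and_congr_right fun _ => forall₂_congr fun n hn => ?_
  rw [(seqRestrict_eq_iff p q n).2 fun i hi => h i (hi.trans_le hn)]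

theorem acc_treeRel_nil_iff (p : ℕ → α) :
    Acc (treeRel J p) [] ↔ ∀ z : ℕ → ℕ, ∃ n, ¬ J (seqRestrict p n) (seqRestrict z n) := by
  rw [acc_iff_isEmpty_descending_chain]
  constructor
  · rintro ⟨h⟩ z
    by_contra! hcon
    refine h ⟨fun n => seqRestrict z n, rfl, fun n => ⟨⟨z n, seqRestrict_succ z n⟩, ?_⟩⟩
    intro m hm
    rw [length_seqRestrict] at hm
    rw [take_seqRestrict _ hm]
    exact hcon m
  · intro h
    refine ⟨fun ⟨f, h0, hf⟩ => ?_⟩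
    choose z hz using fun n => (hf n).1
    have hfz : ∀ n, f n = seqRestrict z n := by
      intro n
      induction n with
      | zero => exact h0
      | succ n ih => rw [hz, ih, seqRestrict_succ]
    obtain ⟨n, hn⟩ := h z
    have := (hf n).2 n (by simp [hfz])
    rw [hfz, take_seqRestrict _ (by omega)] at this
    exact hn this

theorem acc_treeRel {p : ℕ → α} (h : Acc (treeRel J p) []) (σ : List ℕ) :
    Acc (treeRel J p) σ := by
  induction σ using List.reverseRecOn with
  | nil => exact h
  | append_singleton σ k ih =>
    by_cases hr : treeRel J p (σ ++ [k]) σ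
    · exact ih.inv hr
    · refine Acc.intro _ fun τ hτ => (hr ⟨⟨k, rfl⟩, fun n hn => ?_⟩).elim
      obtain ⟨⟨m, rfl⟩, hJ⟩ := hτ
      have := hJ n (hn.trans (by simp))
      rwa [List.take_append_of_le_length hn] at this

theorem measurable_treeRel {X : Type*} [MeasurableSpace X] [Countable α]
    [MeasurableSpace α] [MeasurableSingletonClass α] {g : X → ℕ → α}
    (hg : ∀ i, Measurable fun x => g x i) (τ σ : List ℕ) :
    Measurable fun x => treeRel J (g x) τ σ :=
  Measurable.and measurable_const (Measurable.forall fun n => measurable_const.imp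
    (measurable_seqRestrict_pred hg (fun l => J l (τ.take n)) n))

end Tree

theorem An.simulates {X ι : Type} [MeasurableSpace X] [Countable ι] {r s : X → ι → ι → Prop}
    (hr : ∀ a b, Measurable fun x => r x a b) (hs : ∀ a b, Measurable fun x => s x a b) (a b : ι) :
    An {x | Simulates (r x) a (s x) b} := by
  obtain ⟨e, he⟩ := exists_injective_nat (ι × ι)
  refine ⟨{p | p.2 (e (a, b)) = 0 ∧ ∀ a b, p.2 (e (a, b)) = 0 → ∀ a', r p.1 a' a →
    ∃ b', s p.1 b' b ∧ p.2 (e (a', b')) = 0}, ?_, ?_⟩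
  · have h0 : ∀ q, Measurable fun p : X × (ℕ → ℕ) => p.2 (e q) = 0 := fun q =>
      measurableSet_setOfPred.1 (((measurable_pi_apply (e q)).comp measurable_snd)
        (measurableSet_singleton 0))
    refine measurableSet_setOfPred.2 ((h0 _).and (Measurable.forall fun a => Measurable.forall fun b =>
      (h0 _).imp (Measurable.forall fun a' => Measurable.imp ?_
        (Measurable.exists fun b' => Measurable.and ?_ (h0 _)))))
    · exact (hr a' a).comp measurable_fst
    · exact (hs b' b).comp measurable_fst
  · ext x
    simp only [mem_ofPred_eq]
    constructor
    · rintro ⟨G, hG, h⟩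
      classical
      refine ⟨fun k => if ∃ q, e q = k ∧ G q.1 q.2 then 0 else 1, ?_⟩
      have key : ∀ q, (if ∃ q', e q' = e q ∧ G q'.1 q'.2 then 0 else 1) = 0 ↔ G q.1 q.2 := by
        intro q
        have : (∃ q', e q' = e q ∧ G q'.1 q'.2) ↔ G q.1 q.2 :=
          ⟨fun ⟨q', h1, h2⟩ => he h1 ▸ h2, fun h => ⟨q, rfl, h⟩⟩
        simp [this]
      simp only [key]
      exact ⟨hG, h⟩
    · rintro ⟨z, hz, h⟩
      exact ⟨fun a b => z (e (a, b)) = 0, hz, h⟩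

/-! ### Uniformization -/

section Uniformization

variable (J : List (ℕ × ℕ) → List ℕ → Prop)

/-- The interleaved key sequence: ranks of tree nodes and digits of `y`. -/
noncomputable def unifKey (x y : ℕ → ℕ) (n : ℕ) : Ordinal.{0} :=
  if n % 2 = 0 then relRank (treeRel J fun i => (x i, y i)) (Denumerable.ofNat (List ℕ) (n / 2))
  else y (n / 2)

/-- Analytic form of the inequality between two keys. -/
def UnifLe (x y' y : ℕ → ℕ) (n : ℕ) : Prop :=
  if n % 2 = 0 then Simulates (treeRel J fun i => (x i, y' i)) (Denumerable.ofNat (List ℕ) (n / 2))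
    (treeRel J fun i => (x i, y i)) (Denumerable.ofNat (List ℕ) (n / 2))
  else y' (n / 2) ≤ y (n / 2)

/-- Analytic form of the strict inequality between two keys. -/
def UnifLt (x y' y : ℕ → ℕ) (n : ℕ) : Prop :=
  if n % 2 = 0 then ∃ τ, treeRel J (fun i => (x i, y i)) τ (Denumerable.ofNat (List ℕ) (n / 2)) ∧
    Simulates (treeRel J fun i => (x i, y' i)) (Denumerable.ofNat (List ℕ) (n / 2))
      (treeRel J fun i => (x i, y i)) τ
  else y' (n / 2) < y (n / 2)

variable {J} {x y y' : ℕ → ℕ}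

theorem unifLe_iff (hy' : Acc (treeRel J fun i => (x i, y' i)) [])
    (hy : Acc (treeRel J fun i => (x i, y i)) []) (n : ℕ) :
    UnifLe J x y' y n ↔ unifKey J x y' n ≤ unifKey J x y n := by
  unfold UnifLe unifKey
  split_ifs
  · exact simulates_iff (acc_treeRel hy' _) (acc_treeRel hy _)
  · simp

theorem unifLt_iff (hy' : Acc (treeRel J fun i => (x i, y' i)) [])
    (hy : Acc (treeRel J fun i => (x i, y i)) []) (n : ℕ) :
    UnifLt J x y' y n ↔ unifKey J x y' n < unifKey J x y n := by
  unfold UnifLt unifKey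
  split_ifs
  · constructor
    · rintro ⟨τ, h1, h2⟩
      exact ((simulates_iff (acc_treeRel hy' _) (acc_treeRel hy _)).1 h2).trans_lt
        (relRank_lt_of_rel (acc_treeRel hy _) h1)
    · intro h
      obtain ⟨τ, h1, h2⟩ := exists_rel_of_lt_relRank (acc_treeRel hy _) h
      exact ⟨τ, h1, (simulates_iff (acc_treeRel hy' _) (acc_treeRel hy _)).2 h2⟩
  · simp

theorem acc_of_unif (hy : Acc (treeRel J fun i => (x i, y i)) []) {n : ℕ}
    (h1 : ∀ i < n, UnifLe J x y' y i) (h2 : UnifLt J x y' y n) :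
    Acc (treeRel J fun i => (x i, y' i)) [] := by
  have h0 : Denumerable.ofNat (List ℕ) 0 = [] := by simp
  rcases Nat.eq_zero_or_pos n with rfl | hn
  · obtain ⟨τ, h3, h4⟩ := h2
    have := h4.acc (acc_treeRel hy _)
    simpa [h0] using this
  · have h3 : Simulates _ _ _ _ := h1 0 hn
    have := h3.acc (acc_treeRel hy _)
    simpa [h0] using this

theorem An.unifLe (n : ℕ) :
    An {p : ((ℕ → ℕ) × (ℕ → ℕ)) × (ℕ → ℕ) | UnifLe J p.1.1 p.2 p.1.2 n} := by
  have hx : ∀ i, Measurable fun p : ((ℕ → ℕ) × (ℕ → ℕ)) × (ℕ → ℕ) => p.1.1 i := fun i =>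
    (measurable_pi_apply i).comp (measurable_fst.comp measurable_fst)
  have hy : ∀ i, Measurable fun p : ((ℕ → ℕ) × (ℕ → ℕ)) × (ℕ → ℕ) => p.1.2 i := fun i =>
    (measurable_pi_apply i).comp (measurable_snd.comp measurable_fst)
  have hz : ∀ i, Measurable fun p : ((ℕ → ℕ) × (ℕ → ℕ)) × (ℕ → ℕ) => p.2 i := fun i =>
    (measurable_pi_apply i).comp measurable_snd
  unfold UnifLe
  split_ifs
  · exact An.simulates (fun a b => measurable_treeRel (fun i => (hx i).prodMk (hz i)) a b)
      (fun a b => measurable_treeRel (fun i => (hx i).prodMk (hy i)) a b) _ _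
  · exact An.of_measurableSet (measurableSet_le (hz _) (hy _))

theorem An.unifLt (n : ℕ) :
    An {p : ((ℕ → ℕ) × (ℕ → ℕ)) × (ℕ → ℕ) | UnifLt J p.1.1 p.2 p.1.2 n} := by
  have hx : ∀ i, Measurable fun p : ((ℕ → ℕ) × (ℕ → ℕ)) × (ℕ → ℕ) => p.1.1 i := fun i =>
    (measurable_pi_apply i).comp (measurable_fst.comp measurable_fst)
  have hy : ∀ i, Measurable fun p : ((ℕ → ℕ) × (ℕ → ℕ)) × (ℕ → ℕ) => p.1.2 i := fun i =>
    (measurable_pi_apply i).comp (measurable_snd.comp measurable_fst)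
  have hz : ∀ i, Measurable fun p : ((ℕ → ℕ) × (ℕ → ℕ)) × (ℕ → ℕ) => p.2 i := fun i =>
    (measurable_pi_apply i).comp measurable_snd
  unfold UnifLt
  split_ifs
  · rw [ofPred_exists]
    refine An.iUnion fun τ => An.inter (An.of_measurableSet (measurableSet_setOfPred.2 ?_)) ?_
    · exact measurable_treeRel (fun i => (hx i).prodMk (hy i)) _ _
    · exact An.simulates (fun a b => measurable_treeRel (fun i => (hx i).prodMk (hz i)) a b)
        (fun a b => measurable_treeRel (fun i => (hx i).prodMk (hy i)) a b) _ _
  · exact An.of_measurableSet (measurableSet_lt (hz _) (hy _))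

end Uniformization

theorem unifKey_odd (J : List (ℕ × ℕ) → List ℕ → Prop) (x y : ℕ → ℕ) (n : ℕ) :
    unifKey J x y (2 * n + 1) = y n := by
  have h1 : (2 * n + 1) % 2 = 1 := by omega
  have h2 : (2 * n + 1) / 2 = n := by omega
  simp [unifKey, h1, h2]

theorem unifKey_even (J : List (ℕ × ℕ) → List ℕ → Prop) (x y : ℕ → ℕ) (n : ℕ) :
    unifKey J x y (2 * n) = relRank (treeRel J fun i => (x i, y i)) (Denumerable.ofNat (List ℕ) n) := by
  simp [unifKey]

theorem exists_unif_min (J : List (ℕ × ℕ) → List ℕ → Prop) (x : ℕ → ℕ) {A : Set (ℕ → ℕ)}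
    (hA : A = {y | Acc (treeRel J fun i => (x i, y i)) []}) (hne : A.Nonempty) :
    ∃ y ∈ A, ∀ y' ∈ A, ∀ n, (∀ i < n, unifKey J x y' i ≤ unifKey J x y i) →
      unifKey J x y n ≤ unifKey J x y' n := by
  obtain ⟨y, lam, hodd, hmin, happ⟩ := exists_lexStage_limit (unifKey J x) hne (unifKey_odd J x)
  have hlam : ∀ τ σ, treeRel J (fun i => (x i, y i)) τ σ →
      lam (2 * Encodable.encode τ) < lam (2 * Encodable.encode σ) := by
    intro τ σ h
    obtain ⟨y', hy', h1, h2⟩ := happ (2 * Encodable.encode τ + 2 * Encodable.encode σ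
      + 2 * τ.length + 2)
    rw [← h1 _ (by omega), ← h1 _ (by omega), unifKey_even, unifKey_even,
      Denumerable.ofNat_encode, Denumerable.ofNat_encode]
    rw [hA] at hy'
    refine relRank_lt_of_rel (acc_treeRel hy' _) ((treeRel_congr fun i hi => ?_).1 h)
    rw [h2 i (by omega)]
  have hwf : WellFounded (treeRel J fun i => (x i, y i)) :=
    Subrelation.wf (fun {a b} h => hlam a b h)
      (InvImage.wf (fun σ : List ℕ => lam (2 * Encodable.encode σ)) Ordinal.lt_wf)
  have hyA : y ∈ A := by rw [hA]; exact hwf.apply []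
  have hle : ∀ n, unifKey J x y n ≤ lam n := by
    intro n
    obtain ⟨m, rfl | rfl⟩ := n.even_or_odd'
    · rw [unifKey_even]
      have := relRank_le_of_strictMono (hwf.apply (Denumerable.ofNat (List ℕ) m)) _ hlam
      simpa using this
    · rw [unifKey_odd, hodd]
  have hstage : ∀ n, y ∈ lexStage A (unifKey J x) n := by
    intro n
    induction n with
    | zero => exact hyA
    | succ n ih => exact ⟨ih, fun y' hy' => (hle n).trans (hmin n y' hy')⟩
  exact ⟨y, hyA, fun y' hy' n h =>
    (hstage (n + 1)).2 y' (mem_lexStage_of_le (unifKey J x) hstage hy' n h)⟩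

/-- Kondo's uniformization theorem. -/
theorem coanalytic_uniformization (P : Set ((ℕ → ℕ) × (ℕ → ℕ))) (hP : An Pᶜ) :
    ∃ Q ⊆ P, An Qᶜ ∧ (∀ x y, (x, y) ∈ P → ∃ y', (x, y') ∈ Q) ∧
      ∀ x y y', (x, y) ∈ Q → (x, y') ∈ Q → y = y' := by
  obtain ⟨J, hJ⟩ := exists_normal_form
    ((fun s : ℕ → ℕ × ℕ => ((fun i => (s i).1, fun i => (s i).2) : (ℕ → ℕ) × (ℕ → ℕ))) ⁻¹' P) <| by
    refine (An.preimage hP ?_).analyticSet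
    exact Measurable.prodMk
      (measurable_pi_lambda _ fun n => measurable_fst.comp (measurable_pi_apply n))
      (measurable_pi_lambda _ fun n => measurable_snd.comp (measurable_pi_apply n))
  have hP' : ∀ x y, (x, y) ∈ P ↔ Acc (treeRel J fun i => (x i, y i)) [] := by
    intro x y
    rw [acc_treeRel_nil_iff]
    exact Set.ext_iff.1 hJ fun i => (x i, y i)
  let Q : Set ((ℕ → ℕ) × (ℕ → ℕ)) := {p | p ∈ P ∧
    ¬ ∃ y', ∃ n, (∀ i < n, UnifLe J p.1 y' p.2 i) ∧ UnifLt J p.1 y' p.2 n}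
  have hQ : ∀ x y, (x, y) ∈ Q ↔ (x, y) ∈ P ∧ ∀ y', (x, y') ∈ P → ∀ n,
      (∀ i < n, unifKey J x y' i ≤ unifKey J x y i) → unifKey J x y n ≤ unifKey J x y' n := by
    intro x y
    refine and_congr_right fun hxy => ?_
    rw [hP'] at hxy
    push Not
    constructor
    · intro h y' hy' n hn
      rw [hP'] at hy'
      have := h y' n fun i hi => (unifLe_iff hy' hxy i).2 (hn i hi)
      rwa [unifLt_iff hy' hxy, not_lt] at this
    · intro h y' n hn hlt
      have hy' := acc_of_unif hxy hn hlt
      rw [unifLt_iff hy' hxy] at hlt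
      exact (h y' ((hP' _ _).2 hy') n fun i hi => (unifLe_iff hy' hxy i).1 (hn i hi)).not_gt hlt
  refine ⟨Q, fun p hp => hp.1, ?_, ?_, ?_⟩
  · have : Qᶜ = Pᶜ ∪ {p | ∃ y', (p, y') ∈ ⋃ n, (⋂ i : Fin n,
        {q : ((ℕ → ℕ) × (ℕ → ℕ)) × (ℕ → ℕ) | UnifLe J q.1.1 q.2 q.1.2 i}) ∩
        {q : ((ℕ → ℕ) × (ℕ → ℕ)) × (ℕ → ℕ) | UnifLt J q.1.1 q.2 q.1.2 n}} := by
      ext p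
      simp only [Q, mem_compl_iff, mem_ofPred_eq, not_and, not_not, mem_union, mem_iUnion,
        mem_inter_iff, mem_iInter, Fin.forall_iff]
      tauto
    rw [this]
    exact hP.union (An.proj (An.iUnion fun n =>
      (An.iInter fun i : Fin n => An.unifLe (i : ℕ)).inter (An.unifLt n)))
  · intro x y hxy
    obtain ⟨y', hy', h⟩ := exists_unif_min J x rfl ⟨y, (hP' x y).1 hxy⟩
    exact ⟨y', (hQ _ _).2 ⟨(hP' _ _).2 hy', fun z hz => h z ((hP' _ _).1 hz)⟩⟩
  · intro x y y' h h'
    rw [hQ] at h h'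
    have key : ∀ n, unifKey J x y n = unifKey J x y' n := by
      intro n
      induction n using Nat.strong_induction_on with
      | _ n ih =>
        exact le_antisymm (h.2 y' h'.1 n fun i hi => (ih i hi).ge)
          (h'.2 y h.1 n fun i hi => (ih i hi).le)
    funext n
    have := key (2 * n + 1)
    rw [unifKey_odd, unifKey_odd] at this
    exact_mod_cast this

open scoped Ordinal in
theorem relRank_lt_omega_one {ι : Type} [Countable ι] (r : ι → ι → Prop) (a : ι) :
    relRank r a < ω₁ := by
  by_cases ha : Acc r a
  · induction ha with
    | intro a h ih =>
      have hsup : (⨆ b : {b // r b a}, Order.succ (relRank r b)) < ω₁ :=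
        Ordinal.iSup_lt_omega_one fun b =>
          (Cardinal.isSuccLimit_omega 1).succ_lt (ih b.1 b.2)
      refine (relRank_le (Acc.intro a h) fun b hb => ?_).trans_lt hsup
      exact (Order.lt_succ _).trans_le
        (Ordinal.le_iSup (fun b : {b // r b a} => Order.succ (relRank r b)) ⟨b, hb⟩)
  · rw [relRank, dif_neg ha]
    exact Ordinal.omega_pos 1

/-- The tree searching for a code in the range of `f` with an infinite descending sequence. -/
def descentRel (f : (ℕ → ℕ) → ℕ → ℕ) (l' l : List (ℕ × ℕ)) : Prop :=
  (∃ k, l' = l ++ [k]) ∧ ∃ q : ℕ → ℕ × ℕ, seqRestrict q l'.length = l' ∧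
    ∀ i, i + 1 < l'.length → f (fun j => (q j).1) (Nat.pair (q (i + 1)).2 (q i).2) = 0

theorem acc_descentRel {f : (ℕ → ℕ) → ℕ → ℕ} (hf : Continuous f)
    (hwf : ∀ z, WellFounded fun a b => f z (Nat.pair a b) = 0) :
    Acc (descentRel f) [] := by
  rw [acc_iff_isEmpty_descending_chain]
  refine ⟨fun ⟨l, h0, hl⟩ => ?_⟩
  choose q hq using fun n => (hl n).1
  have hlq : ∀ n, l n = seqRestrict q n := by
    intro n
    induction n with
    | zero => exact h0
    | succ n ih => rw [hq, ih, seqRestrict_succ]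
  choose p hp hp' using fun n => (hl n).2
  simp only [hlq, length_seqRestrict, seqRestrict_eq_iff] at hp hp'
  have hlim : Tendsto (fun n => fun j => (p n j).1) atTop (𝓝 fun j => (q j).1) :=
    tendsto_of_forall_lt_eq fun n i hi => by rw [hp n i (by omega)]
  have hlim' := (hf.tendsto _).comp hlim
  refine (wellFounded_iff_isEmpty_descending_chain.1 (hwf fun j => (q j).1)).false
    ⟨fun n => (q n).2, fun n => ?_⟩
  have h1 := tendsto_pi_nhds.1 hlim' (Nat.pair (q (n + 1)).2 (q n).2)
  refine tendsto_nhds_unique h1 (tendsto_const_nhds.congr' ?_)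
  filter_upwards [eventually_gt_atTop (n + 1)] with m hm
  have := hp' m n (by omega)
  rw [hp m n (by omega), hp m (n + 1) (by omega)] at this
  exact this.symm

theorem acc_descentRel' {f : (ℕ → ℕ) → ℕ → ℕ} (h : Acc (descentRel f) []) (l : List (ℕ × ℕ)) :
    Acc (descentRel f) l := by
  induction l using List.reverseRecOn with
  | nil => exact h
  | append_singleton l k ih =>
    by_cases hr : descentRel f (l ++ [k]) l
    · exact ih.inv hr
    · refine Acc.intro _ fun l' hl' => (hr ⟨⟨k, rfl⟩, ?_⟩).elim
      obtain ⟨⟨m, rfl⟩, q, hq, hq'⟩ := hl'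
      refine ⟨q, ?_, fun i hi => hq' i (by simp at hi ⊢; omega)⟩
      have := congrArg (List.take (l ++ [k]).length) hq
      rwa [take_seqRestrict _ (by simp), List.take_left] at this

theorem relRank_le_descentRel {f : (ℕ → ℕ) → ℕ → ℕ} (h : Acc (descentRel f) [])
    (z : ℕ → ℕ) (hwf : WellFounded fun a b => f z (Nat.pair a b) = 0) (a : ℕ) :
    ∀ (n : ℕ) (t : ℕ → ℕ), t n = a → (∀ i < n, f z (Nat.pair (t (i + 1)) (t i)) = 0) →
      relRank (fun a b => f z (Nat.pair a b) = 0) a ≤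
        relRank (descentRel f) (seqRestrict (fun i => (z i, t i)) (n + 1)) := by
  induction a using hwf.induction with
  | _ a ih =>
    intro n t hta ht
    refine relRank_le (hwf.apply a) fun b hb => ?_
    let t' : ℕ → ℕ := fun i => if i ≤ n then t i else b
    have ht' : ∀ i ≤ n, t' i = t i := fun i hi => if_pos hi
    have hb' : t' (n + 1) = b := if_neg (by omega)
    have hdesc : ∀ i < n + 1, f z (Nat.pair (t' (i + 1)) (t' i)) = 0 := by
      intro i hi
      rcases Nat.lt_succ_iff_lt_or_eq.1 hi with h1 | rfl
      · rw [ht' i (by omega), ht' (i + 1) (by omega)]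
        exact ht i h1
      · rw [hb', ht' i le_rfl, hta]
        exact hb
    refine (ih b hb (n + 1) t' hb' hdesc).trans_lt
      (relRank_lt_of_rel (acc_descentRel' h _) ⟨⟨(z (n + 1), b), ?_⟩, ?_⟩)
    · rw [seqRestrict_succ, hb']
      congr 1
      exact (seqRestrict_eq_iff _ _ _).2 fun i hi => by rw [ht' i (by omega)]
    · refine ⟨fun i => (z i, t' i), by simp, fun i hi => hdesc i (by simp at hi; omega)⟩

open scoped Ordinal in
/-- Boundedness: an analytic set of well-founded relations on `ℕ` has countably bounded ranks. -/
theorem An.exists_bound {X : Type} [MeasurableSpace X] {g : (ℕ → ℕ) → X} (hg : Measurable g)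
    (hgs : Function.Surjective g) {C : Set X} (hC : An C) {w : X → ℕ → ℕ → Prop}
    (hw : ∀ a b, Measurable fun x => w x a b) (hwf : ∀ x ∈ C, WellFounded (w x)) :
    ∃ α < ω₁, ∀ x ∈ C, ∀ a, relRank (w x) a < α := by
  classical
  have hW : An {G : ℕ → ℕ | ∃ x, (G, x) ∈ {p : (ℕ → ℕ) × X | p.2 ∈ C ∧
      ∀ a b, p.1 (Nat.pair a b) = 0 ↔ w p.2 a b}} := by
    refine An.proj_of_surjective (An.inter (hC.preimage measurable_snd) (An.of_measurableSet
      (measurableSet_setOfPred.2 ?_))) hg hgs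
    refine Measurable.forall fun a => Measurable.forall fun b => Measurable.iff ?_ ?_
    · exact measurableSet_setOfPred.1 (((measurable_pi_apply _).comp measurable_fst)
        (measurableSet_singleton 0))
    · exact (hw a b).comp measurable_snd
  have hW' := hW.analyticSet
  have hcode : ∀ x ∈ C, ∃ G : ℕ → ℕ, (∀ a b, G (Nat.pair a b) = 0 ↔ w x a b) := fun x _ =>
    ⟨fun k : ℕ => if w x k.unpair.1 k.unpair.2 then 0 else 1, fun a b => by simp⟩
  rw [AnalyticSet] at hW'
  rcases hW' with h | ⟨f, hf, hr⟩
  · refine ⟨0, Ordinal.omega_pos 1, fun x hx => ?_⟩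
    obtain ⟨G, hG⟩ := hcode x hx
    exact (h.subset (show G ∈ _ from ⟨x, hx, hG⟩)).elim
  · have hfwf : ∀ z, WellFounded fun a b => f z (Nat.pair a b) = 0 := by
      intro z
      obtain ⟨x, hx, hG⟩ := hr.subset ⟨z, rfl⟩
      have : (fun a b => f z (Nat.pair a b) = 0) = w x := by
        funext a b
        exact propext (hG a b)
      rw [this]
      exact hwf x hx
    have hacc := acc_descentRel hf hfwf
    refine ⟨Order.succ (⨆ l, relRank (descentRel f) l), (Cardinal.isSuccLimit_omega 1).succ_lt
      (Ordinal.iSup_lt_omega_one fun l => relRank_lt_omega_one _ _), fun x hx a => ?_⟩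
    obtain ⟨G, hG⟩ := hcode x hx
    obtain ⟨z, rfl⟩ : G ∈ range f := hr ▸ ⟨x, hx, hG⟩
    have : (fun a b => f z (Nat.pair a b) = 0) = w x := by
      funext a b
      exact propext (hG a b)
    rw [← this, Order.lt_succ_iff]
    exact (relRank_le_descentRel hacc z (hfwf z) a 0 (fun _ => a) rfl (by simp)).trans
      (Ordinal.le_iSup _ _)

theorem exists_measurable_surjective (Y : Type) [MeasurableSpace Y] [StandardBorelSpace Y]
    [Nonempty Y] : ∃ g : (ℕ → ℕ) → Y, Measurable g ∧ Function.Surjective g := by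
  let := upgradeStandardBorel Y
  obtain ⟨g, hg, hs⟩ := PolishSpace.exists_nat_nat_continuous_surjective Y
  exact ⟨g, hg.measurable, hs⟩

/-- Projections of coanalytic sets along Baire space. -/
def Sigma2 {X : Type*} [MeasurableSpace X] (S : Set X) : Prop :=
  ∃ B : Set (X × (ℕ → ℕ)), An Bᶜ ∧ S = {x | ∃ z, (x, z) ∈ B}

namespace Sigma2

variable {X Y : Type*} [MeasurableSpace X] [MeasurableSpace Y]

theorem of_compl {S : Set X} (h : An Sᶜ) : Sigma2 S :=
  ⟨Prod.fst ⁻¹' S, h.preimage measurable_fst, by simp⟩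

theorem of_an {S : Set X} (h : An S) : Sigma2 S := by
  obtain ⟨B, hB, rfl⟩ := h
  exact ⟨B, An.of_measurableSet hB.compl, rfl⟩

theorem iUnion {ι : Type*} [Countable ι] {S : ι → Set X} (h : ∀ i, Sigma2 (S i)) :
    Sigma2 (⋃ i, S i) := by
  choose B hB hS using h
  refine ⟨⋃ i, B i, by rw [compl_iUnion]; exact An.iInter hB, ?_⟩
  ext x
  simp only [hS, mem_iUnion, mem_ofPred_eq]
  exact exists_comm

theorem iInter {ι : Type*} [Countable ι] {S : ι → Set X} (h : ∀ i, Sigma2 (S i)) :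
    Sigma2 (⋂ i, S i) := by
  choose B hB hS using h
  obtain ⟨e, he⟩ := exists_injective_nat ι
  refine ⟨⋂ i, (fun p : X × (ℕ → ℕ) => (p.1, fun n => p.2 (Nat.pair (e i) n))) ⁻¹' B i, ?_, ?_⟩
  · rw [compl_iInter]
    refine An.iUnion fun i => (hB i).preimage ?_
    refine Measurable.prodMk measurable_fst (measurable_pi_lambda _ fun n => ?_)
    exact (measurable_pi_apply _).comp measurable_snd
  · ext x
    simp only [hS, mem_iInter, mem_ofPred_eq, mem_preimage]
    constructor
    · intro hx
      choose z hz using hx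
      classical
      refine ⟨fun k => if h : ∃ i, e i = k.unpair.1 then z h.choose k.unpair.2 else 0,
        fun i => ?_⟩
      have h1 : ∃ j, e j = e i := ⟨i, rfl⟩
      have h2 : h1.choose = i := he h1.choose_spec
      convert hz i using 2
      funext n
      simp only [Nat.unpair_pair]
      rw [dif_pos h1, h2]
    · rintro ⟨z, hz⟩ i
      exact ⟨_, hz i⟩

theorem inter {S T : Set X} (hS : Sigma2 S) (hT : Sigma2 T) : Sigma2 (S ∩ T) := by
  rw [inter_eq_iInter]
  exact iInter (by rintro (_ | _) <;> assumption)

theorem union {S T : Set X} (hS : Sigma2 S) (hT : Sigma2 T) : Sigma2 (S ∪ T) := by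
  rw [union_eq_iUnion]
  exact iUnion (by rintro (_ | _) <;> assumption)

theorem preimage {S : Set Y} (hS : Sigma2 S) {f : X → Y} (hf : Measurable f) :
    Sigma2 (f ⁻¹' S) := by
  obtain ⟨B, hB, rfl⟩ := hS
  exact ⟨(fun p : X × (ℕ → ℕ) => (f p.1, p.2)) ⁻¹' B,
    hB.preimage ((hf.comp measurable_fst).prodMk measurable_snd), by ext; simp⟩

end Sigma2

/-- Predicates that are `Sigma2` together with their negation. -/
def Delta2 {X : Type*} [MeasurableSpace X] (p : X → Prop) : Prop :=
  Sigma2 {x | p x} ∧ Sigma2 {x | ¬ p x}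

namespace Delta2

variable {X Y : Type*} [MeasurableSpace X] [MeasurableSpace Y] {p q : X → Prop}

theorem of_an (h : An {x | p x}) : Delta2 p :=
  ⟨.of_an h, .of_compl (by convert h using 1; ext; simp)⟩

theorem of_measurable (h : Measurable p) : Delta2 p :=
  of_an (.of_measurableSet (measurableSet_setOfPred.2 h))

theorem not (h : Delta2 p) : Delta2 fun x => ¬ p x :=
  ⟨h.2, by simpa only [not_not] using h.1⟩

theorem all {ι : Type*} [Countable ι] {p : ι → X → Prop} (h : ∀ i, Delta2 (p i)) :
    Delta2 fun x => ∀ i, p i x := by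
  constructor
  · convert Sigma2.iInter fun i => (h i).1 using 1
    ext; simp
  · convert Sigma2.iUnion fun i => (h i).2 using 1
    ext; simp

theorem ex {ι : Type*} [Countable ι] {p : ι → X → Prop} (h : ∀ i, Delta2 (p i)) :
    Delta2 fun x => ∃ i, p i x := by
  simpa only [not_forall, not_not] using (Delta2.all fun i => (h i).not).not

theorem and (hp : Delta2 p) (hq : Delta2 q) : Delta2 fun x => p x ∧ q x := by
  constructor
  · exact hp.1.inter hq.1
  · convert hp.2.union hq.2 using 1
    ext
    exact Classical.not_and_iff_not_or_not

theorem or (hp : Delta2 p) (hq : Delta2 q) : Delta2 fun x => p x ∨ q x := by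
  simpa only [not_and, not_not, or_iff_not_imp_left] using (hp.not.and hq.not).not

theorem imp (hp : Delta2 p) (hq : Delta2 q) : Delta2 fun x => p x → q x := by
  simpa only [imp_iff_not_or] using hp.not.or hq

theorem iff (hp : Delta2 p) (hq : Delta2 q) : Delta2 fun x => p x ↔ q x := by
  simpa only [iff_iff_implies_and_implies] using (hp.imp hq).and (hq.imp hp)

theorem comp {p : Y → Prop} (hp : Delta2 p) {f : X → Y} (hf : Measurable f) :
    Delta2 fun x => p (f x) :=
  ⟨hp.1.preimage hf, hp.2.preimage hf⟩

end Delta2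

open scoped Ordinal in
theorem countable_proj_of_bounded_baire (H : CoanalyticPSP) {P : Set ((ℕ → ℕ) × (ℕ → ℕ))}
    (hP : An Pᶜ) {w : (ℕ → ℕ) → ℕ → ℕ → Prop} (hw : ∀ a b, Measurable fun y => w y a b)
    (hwf : ∀ x y, (x, y) ∈ P → WellFounded (w y))
    (hb : ∀ α < ω₁, {x | ∃ y, (x, y) ∈ P ∧ ∀ a, relRank (w y) a < α}.Countable) :
    {x | ∃ y, (x, y) ∈ P}.Countable := by
  obtain ⟨Q, hQP, hQ, hdom, hfun⟩ := coanalytic_uniformization P hP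
  have hpQ : {x | ∃ y, (x, y) ∈ P} ⊆ Prod.fst '' Q := by
    rintro x ⟨y, hxy⟩
    obtain ⟨y', hy'⟩ := hdom x y hxy
    exact ⟨_, hy', rfl⟩
  rcases H.standardBorel Q hQ with h | ⟨C, hCQ, hC, hCc⟩
  · exact (h.image _).mono hpQ
  · obtain ⟨g, hg, hgs⟩ := exists_measurable_surjective ((ℕ → ℕ) × (ℕ → ℕ))
    obtain ⟨α, hα, hbd⟩ := An.exists_bound hg hgs hC (w := fun p => w p.2)
      (fun a b => (hw a b).comp measurable_snd) (fun p hp => hwf p.1 p.2 (hQP (hCQ hp)))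
    refine (hCc ?_).elim
    refine countable_of_injective_of_countable_image (f := Prod.fst) ?_
      ((hb α hα).mono ?_)
    · rintro ⟨x, y⟩ h1 ⟨x', y'⟩ h2 (rfl : x = x')
      rw [hfun x y y' (hCQ h1) (hCQ h2)]
    · rintro _ ⟨p, hp, rfl⟩
      exact ⟨p.2, hQP (hCQ hp), hbd p hp⟩

open scoped Ordinal in
/-- If a `Sigma2` set of pairs carries well-founded relations on its second coordinates such that
bounded ranks occur only above countably many points, then its projection is countable. -/
theorem countable_proj_of_bounded (H : CoanalyticPSP) {X Y : Type} [MeasurableSpace X]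
    [StandardBorelSpace X] [MeasurableSpace Y] [StandardBorelSpace Y] [Nonempty Y]
    {T : Set (X × Y)} (hT : Sigma2 T) {w : Y → ℕ → ℕ → Prop}
    (hw : ∀ a b, Measurable fun y => w y a b)
    (hwf : ∀ x y, (x, y) ∈ T → WellFounded (w y))
    (hb : ∀ α < ω₁, {x | ∃ y, (x, y) ∈ T ∧ ∀ a, relRank (w y) a < α}.Countable) :
    {x | ∃ y, (x, y) ∈ T}.Countable := by
  by_cases hX : Countable X
  · exact to_countable _
  have hN : ¬ Countable (ℕ → ℕ) := by
    intro h
    refine not_countable_cantor (countable_of_injective_of_countable_image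
      (f := fun (x : ℕ → Bool) i => (x i).toNat) ?_ (to_countable _))
    intro x _ y _ h
    funext i
    have h' : (x i).toNat = (y i).toNat := congrFun h i
    revert h'
    cases x i <;> cases y i <;> simp
  let e : X ≃ᵐ (ℕ → ℕ) := PolishSpace.measurableEquivOfNotCountable hX hN
  obtain ⟨g, hg, hgs⟩ := exists_measurable_surjective Y
  obtain ⟨B, hB, rfl⟩ := hT
  let ev : (ℕ → ℕ) → ℕ → ℕ := fun v n => v (2 * n)
  let od : (ℕ → ℕ) → ℕ → ℕ := fun v n => v (2 * n + 1)
  have hev : Measurable ev := measurable_pi_lambda _ fun n => measurable_pi_apply _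
  have hod : Measurable od := measurable_pi_lambda _ fun n => measurable_pi_apply _
  have hsplit : ∀ y z : ℕ → ℕ, ∃ v, ev v = y ∧ od v = z := by
    intro y z
    refine ⟨fun n => if n % 2 = 0 then y (n / 2) else z (n / 2), ?_, ?_⟩
    · funext n
      simp [ev]
    · funext n
      have h1 : (2 * n + 1) % 2 = 1 := by omega
      have h2 : (2 * n + 1) / 2 = n := by omega
      simp [od, h1, h2]
  have key := countable_proj_of_bounded_baire H
    (P := (fun p : (ℕ → ℕ) × (ℕ → ℕ) => ((e.symm p.1, g (ev p.2)), od p.2)) ⁻¹' B)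
    (hB.preimage (((e.symm.measurable.comp measurable_fst).prodMk
      (hg.comp (hev.comp measurable_snd))).prodMk (hod.comp measurable_snd)))
    (w := fun v => w (g (ev v))) (fun a b => (hw a b).comp (hg.comp hev))
    (fun x y h => hwf (e.symm x) _ ⟨_, h⟩) (fun α hα => ((hb α hα).image e).mono ?_)
  · refine (key.image e.symm).mono ?_
    rintro x ⟨y, z, h⟩
    obtain ⟨y, rfl⟩ := hgs y
    obtain ⟨v, rfl, rfl⟩ := hsplit y z
    exact ⟨e x, ⟨v, by simpa using h⟩, by simp⟩
  · rintro x ⟨v, h, hv⟩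
    exact ⟨e.symm x, ⟨g (ev v), ⟨od v, h⟩, hv⟩, by simp⟩

/-! ### Ranked branches and the derivation step -/

/-- The predicate `p` holds infinitely often. -/
def InfOften (p : ℕ → Prop) : Prop := ∀ N, ∃ k, N ≤ k ∧ p k

theorem infOften_iff {p : ℕ → Prop} : InfOften p ↔ {k | p k}.Infinite := by
  rw [← Nat.frequently_atTop_iff_infinite, frequently_atTop]
  rfl

theorem InfOften.mono {p q : ℕ → Prop} (h : InfOften p) (hpq : ∀ k, p k → q k) : InfOften q :=
  fun N => (h N).imp fun k hk => ⟨hk.1, hpq k hk.2⟩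

theorem InfOften.or {p q : ℕ → Prop} (h : InfOften fun k => p k ∨ q k) :
    InfOften p ∨ InfOften q := by
  simp only [infOften_iff] at h ⊢
  exact infinite_union.1 h

/-- `p` meets infinitely many members of the sequence `Y` in an infinite set. -/
def BigPos (Y : ℕ → ℕ → Prop) (p : ℕ → Prop) : Prop :=
  InfOften fun n => InfOften fun k => p k ∧ Y n k

theorem BigPos.mono {Y : ℕ → ℕ → Prop} {p q : ℕ → Prop} (h : BigPos Y p)
    (hpq : ∀ k, p k → q k) : BigPos Y q :=
  InfOften.mono h fun _ hn => hn.mono fun k hk => ⟨hpq k hk.1, hk.2⟩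

theorem BigPos.or {Y : ℕ → ℕ → Prop} {p q : ℕ → Prop} (h : BigPos Y fun k => p k ∨ q k) :
    BigPos Y p ∨ BigPos Y q :=
  (InfOften.mono h fun _ hn => (hn.mono fun _ hk => or_and_right.1 hk).or).or

theorem BigPos.infOften {Y : ℕ → ℕ → Prop} {p : ℕ → Prop} (h : BigPos Y p) : InfOften p :=
  let ⟨_, _, hn⟩ := h 0
  hn.mono fun _ hk => hk.1

/-- `k` belongs to all sets `d i` with `i` listed in `s`. -/
def MeetAll {ι : Type*} (d : ι → ℕ → Prop) (s : List ι) (k : ℕ) : Prop := ∀ i ∈ s, d i k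

section Derivation

variable (J : List (Bool × ℕ) → List ℕ → Prop) (Y : ℕ → ℕ → Prop) {ι κ : Type*}

/-- `h` ranks the tree of attempts to follow `J` along `u`. -/
def Ranked (lt : ι → ι → Prop) (u : ℕ → Bool × ℕ) (h : ℕ → ι) : Prop :=
  ∀ i j, treeRel J u (Denumerable.ofNat (List ℕ) j) (Denumerable.ofNat (List ℕ) i) →
    lt (h j) (h i)

/-- Ranked codes through the finite condition `(c, l)` with ranks below `m`, coding a set that is
positive with respect to the sets `d i` for `i` below `m`. -/
structure Branch (lt : ι → ι → Prop) (d : ι → ℕ → Prop) (m : ι) (c : List (Bool × ℕ))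
    (l : List ι) (u : ℕ → Bool × ℕ) (h : ℕ → ι) : Prop where
  ranked : Ranked J lt u h
  lt_top : ∀ i, lt (h i) m
  fst : seqRestrict u c.length = c
  snd : seqRestrict h l.length = l
  pos : ∀ s : List ι, (∀ i ∈ s, lt i m) → InfOften fun k => (u k).1 = true ∧ MeetAll d s k

theorem branch_iff {J : List (Bool × ℕ) → List ℕ → Prop} {lt : ι → ι → Prop} {d : ι → ℕ → Prop}
    {m : ι} {c : List (Bool × ℕ)} {l : List ι} {u : ℕ → Bool × ℕ} {h : ℕ → ι} :
    Branch J lt d m c l u h ↔ Ranked J lt u h ∧ (∀ i, lt (h i) m) ∧ seqRestrict u c.length = c ∧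
      seqRestrict h l.length = l ∧ ∀ s : List ι, (∀ i ∈ s, lt i m) →
        InfOften fun k => (u k).1 = true ∧ MeetAll d s k :=
  ⟨fun ⟨h1, h2, h3, h4, h5⟩ => ⟨h1, h2, h3, h4, h5⟩, fun ⟨h1, h2, h3, h4, h5⟩ =>
    ⟨h1, h2, h3, h4, h5⟩⟩

/-- The union of the sets coded by the branches through `(c, l)`. -/
def BranchUnion (lt : ι → ι → Prop) (d : ι → ℕ → Prop) (m : ι) (c : List (Bool × ℕ))
    (l : List ι) (k : ℕ) : Prop :=
  ∃ u h, Branch J lt d m c l u h ∧ (u k).1 = true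

/-- The complement of the union of branches through `(c, l)` may be used as the next set. -/
def Good (lt : ι → ι → Prop) (d : ι → ℕ → Prop) (m : ι) (c : List (Bool × ℕ)) (l : List ι) :
    Prop :=
  (∃ k, BranchUnion J lt d m c l k) ∧
    ∀ s : List ι, (∀ i ∈ s, lt i m) →
      BigPos Y fun k => MeetAll d s k ∧ ¬ BranchUnion J lt d m c l k

/-- The canonical ordering of finite conditions. -/
def Before (lt : ι → ι → Prop) : List (Bool × ℕ) × List ι → List (Bool × ℕ) × List ι → Prop :=
  InvImage (Prod.Lex (· < ·) (List.Shortlex lt)) fun p => (Encodable.encode p.1, p.2)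

/-- `X` is the set chosen at stage `m`. -/
def IsNext (lt : ι → ι → Prop) (d : ι → ℕ → Prop) (m : ι) (X : ℕ → Prop) : Prop :=
  (∃ c l, Good J Y lt d m c l ∧ (∀ c' l', Good J Y lt d m c' l' → ¬ Before lt (c', l') (c, l)) ∧
    ∀ k, X k ↔ ¬ BranchUnion J lt d m c l k) ∨
  ((∀ c l, ¬ Good J Y lt d m c l) ∧ ∀ k, X k)

variable {J Y}

theorem lex_cons_cons {lt : ι → ι → Prop} {a b : ι} {l l' : List ι} :
    List.Lex lt (a :: l) (b :: l') ↔ lt a b ∨ a = b ∧ List.Lex lt l l' := by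
  constructor
  · rintro (_ | h | h)
    · exact Or.inl ‹_›
    · exact Or.inr ⟨rfl, ‹_›⟩
  · rintro (h | ⟨rfl, h⟩)
    · exact List.Lex.rel h
    · exact List.Lex.cons h

theorem lex_map_iff {lt : ι → ι → Prop} {lt' : κ → κ → Prop} {e : ι → κ}
    (he : Function.Injective e) (hlt : ∀ a b, lt a b ↔ lt' (e a) (e b)) (l l' : List ι) :
    List.Lex lt' (l.map e) (l'.map e) ↔ List.Lex lt l l' := by
  induction l generalizing l' with
  | nil => cases l' <;> simp
  | cons a l ih =>
    cases l' with
    | nil => simp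
    | cons b l' => simp only [List.map_cons, lex_cons_cons, ih, he.eq_iff, hlt]

theorem before_map_iff {lt : ι → ι → Prop} {lt' : κ → κ → Prop} {e : ι → κ}
    (he : Function.Injective e) (hlt : ∀ a b, lt a b ↔ lt' (e a) (e b))
    (c c' : List (Bool × ℕ)) (l l' : List ι) :
    Before lt' (c', l'.map e) (c, l.map e) ↔ Before lt (c', l') (c, l) := by
  simp only [Before, InvImage, Prod.lex_def, List.shortlex_def, List.length_map,
    lex_map_iff he hlt]

theorem wellFounded_before {lt : ι → ι → Prop} (h : WellFounded lt) :
    WellFounded (Before lt) :=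
  InvImage.wf _ (WellFounded.prod_lex wellFounded_lt (List.Shortlex.wf h))

theorem before_trichotomous {lt : ι → ι → Prop} [Std.Trichotomous lt]
    {p q : List (Bool × ℕ) × List ι} (h1 : ¬ Before lt p q) (h2 : ¬ Before lt q p) : p = q := by
  obtain ⟨c, l⟩ := p
  obtain ⟨c', l'⟩ := q
  simp only [Before, InvImage, Prod.lex_def, not_or, not_and, not_lt] at h1 h2
  have hc : Encodable.encode c = Encodable.encode c' := le_antisymm h2.1 h1.1
  have hl : l = l' := Std.Trichotomous.trichotomous (r := List.Shortlex lt) _ _ (h1.2 hc)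
    (h2.2 hc.symm)
  rw [Encodable.encode_injective hc, hl]

theorem IsNext.unique {lt : ι → ι → Prop} [Std.Trichotomous lt] {d : ι → ℕ → Prop} {m : ι}
    {X X' : ℕ → Prop} (h : IsNext J Y lt d m X) (h' : IsNext J Y lt d m X') : X = X' := by
  funext k
  apply propext
  rcases h with ⟨c, l, hg, hmin, hX⟩ | ⟨hn, hX⟩ <;>
    rcases h' with ⟨c', l', hg', hmin', hX'⟩ | ⟨hn', hX'⟩
  · obtain ⟨rfl, rfl⟩ := Prod.mk.inj (before_trichotomous (hmin' _ _ hg) (hmin _ _ hg'))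
    rw [hX, hX']
  · exact (hn' _ _ hg).elim
  · exact (hn _ _ hg').elim
  · exact iff_of_true (hX k) (hX' k)

theorem exists_isNext {lt : ι → ι → Prop} (hwf : WellFounded lt) (d : ι → ℕ → Prop) (m : ι) :
    ∃ X, IsNext J Y lt d m X := by
  by_cases h : ∃ p : List (Bool × ℕ) × List ι, Good J Y lt d m p.1 p.2
  · obtain ⟨⟨c, l⟩, hp, hmin⟩ := (wellFounded_before hwf).has_min
      {p | Good J Y lt d m p.1 p.2} h
    exact ⟨_, Or.inl ⟨c, l, hp, fun c' l' h' => hmin (c', l') h', fun k => Iff.rfl⟩⟩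
  · exact ⟨fun _ => True, Or.inr ⟨fun c l h' => h ⟨(c, l), h'⟩, fun _ => trivial⟩⟩

section Transfer

variable {lt : ι → ι → Prop} {lt' : κ → κ → Prop} {e : ι → κ} {d : ι → ℕ → Prop}
  {d' : κ → ℕ → Prop} {m : ι}

theorem seqRestrict_comp_eq_map {α β : Type*} {e : α → β} (he : Function.Injective e)
    (h : ℕ → α) (l : List α) :
    seqRestrict (e ∘ h) (l.map e).length = l.map e ↔ seqRestrict h l.length = l := by
  rw [← (List.map_injective_iff.2 he).eq_iff]
  simp [seqRestrict]

theorem exists_map_of_below (hinit : ∀ a k, lt' k (e a) → ∃ b, e b = k) {s : List κ}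
    (hs : ∀ i ∈ s, lt' i (e m)) : ∃ s', List.map e s' = s := by
  have : s ∈ range (List.map e) := by
    rw [range_list_map]
    exact fun i hi => hinit m i (hs i hi)
  exact this

theorem meetAll_map (hd : ∀ a, lt a m → d a = d' (e a)) {s : List ι} (hs : ∀ i ∈ s, lt i m)
    (k : ℕ) : MeetAll d' (s.map e) k ↔ MeetAll d s k := by
  simp only [MeetAll, List.forall_mem_map]
  exact forall₂_congr fun i hi => by rw [hd i (hs i hi)]

theorem forall_below_iff (hlt : ∀ a b, lt a b ↔ lt' (e a) (e b))
    (hinit : ∀ a k, lt' k (e a) → ∃ b, e b = k) (hd : ∀ a, lt a m → d a = d' (e a))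
    {F : (ℕ → Prop) → Prop} :
    (∀ s : List κ, (∀ i ∈ s, lt' i (e m)) → F (MeetAll d' s)) ↔
      ∀ s : List ι, (∀ i ∈ s, lt i m) → F (MeetAll d s) := by
  constructor
  · intro h s hs
    have := h (s.map e) (by simpa only [List.forall_mem_map, ← hlt] using hs)
    rwa [show MeetAll d' (s.map e) = MeetAll d s from
      funext fun k => propext (meetAll_map hd hs k)] at this
  · intro h s hs
    obtain ⟨s, rfl⟩ := exists_map_of_below hinit hs
    simp only [List.forall_mem_map, ← hlt] at hs
    rw [show MeetAll d' (s.map e) = MeetAll d s from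
      funext fun k => propext (meetAll_map hd hs k)]
    exact h s hs

theorem branch_map_iff (he : Function.Injective e) (hlt : ∀ a b, lt a b ↔ lt' (e a) (e b))
    (hinit : ∀ a k, lt' k (e a) → ∃ b, e b = k) (hd : ∀ a, lt a m → d a = d' (e a))
    (c : List (Bool × ℕ)) (l : List ι) (u : ℕ → Bool × ℕ) (h : ℕ → ι) :
    Branch J lt' d' (e m) c (l.map e) u (e ∘ h) ↔ Branch J lt d m c l u h := by
  have hpos := forall_below_iff hlt hinit hd
    (F := fun p => InfOften fun k => (u k).1 = true ∧ p k)
  constructor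
  · rintro ⟨h1, h2, h3, h4, h5⟩
    exact ⟨fun i j hij => (hlt _ _).2 (h1 i j hij), fun i => (hlt _ _).2 (h2 i), h3,
      (seqRestrict_comp_eq_map he h l).1 h4, hpos.1 h5⟩
  · rintro ⟨h1, h2, h3, h4, h5⟩
    exact ⟨fun i j hij => (hlt _ _).1 (h1 i j hij), fun i => (hlt _ _).1 (h2 i), h3,
      (seqRestrict_comp_eq_map he h l).2 h4, hpos.2 h5⟩

theorem branchUnion_map (he : Function.Injective e) (hlt : ∀ a b, lt a b ↔ lt' (e a) (e b))
    (hinit : ∀ a k, lt' k (e a) → ∃ b, e b = k) (hd : ∀ a, lt a m → d a = d' (e a))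
    (c : List (Bool × ℕ)) (l : List ι) :
    BranchUnion J lt' d' (e m) c (l.map e) = BranchUnion J lt d m c l := by
  funext k
  apply propext
  constructor
  · rintro ⟨u, h, hb, hk⟩
    choose h' hh' using fun i => hinit m (h i) (hb.lt_top i)
    obtain rfl : e ∘ h' = h := funext hh'
    exact ⟨u, h', (branch_map_iff he hlt hinit hd c l u h').1 hb, hk⟩
  · rintro ⟨u, h, hb, hk⟩
    exact ⟨u, e ∘ h, (branch_map_iff he hlt hinit hd c l u h).2 hb, hk⟩

theorem good_map_iff (he : Function.Injective e) (hlt : ∀ a b, lt a b ↔ lt' (e a) (e b))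
    (hinit : ∀ a k, lt' k (e a) → ∃ b, e b = k) (hd : ∀ a, lt a m → d a = d' (e a))
    (c : List (Bool × ℕ)) (l : List ι) :
    Good J Y lt' d' (e m) c (l.map e) ↔ Good J Y lt d m c l := by
  rw [Good, Good, branchUnion_map he hlt hinit hd]
  exact and_congr_right fun _ => forall_below_iff hlt hinit hd
    (F := fun p => BigPos Y fun k => p k ∧ ¬ BranchUnion J lt d m c l k)

theorem Good.exists_map (hinit : ∀ a k, lt' k (e a) → ∃ b, e b = k)
    {c : List (Bool × ℕ)} {l : List κ} (h : Good J Y lt' d' (e m) c l) :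
    ∃ l', List.map e l' = l := by
  obtain ⟨k, u, g, hb, hk⟩ := h.1
  refine exists_map_of_below (m := m) hinit fun i hi => ?_
  rw [← hb.snd, seqRestrict, List.mem_map] at hi
  obtain ⟨j, -, rfl⟩ := hi
  exact hb.lt_top j

theorem isNext_map_iff (he : Function.Injective e) (hlt : ∀ a b, lt a b ↔ lt' (e a) (e b))
    (hinit : ∀ a k, lt' k (e a) → ∃ b, e b = k) (hd : ∀ a, lt a m → d a = d' (e a))
    (X : ℕ → Prop) :
    IsNext J Y lt' d' (e m) X ↔ IsNext J Y lt d m X := by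
  refine or_congr ⟨?_, ?_⟩ (and_congr_left fun _ => ⟨?_, ?_⟩)
  · rintro ⟨c, l, hg, hmin, hX⟩
    obtain ⟨l, rfl⟩ := hg.exists_map hinit
    refine ⟨c, l, (good_map_iff he hlt hinit hd c l).1 hg, fun c' l' h' => ?_, fun k => ?_⟩
    · rw [← before_map_iff he hlt]
      exact hmin c' _ ((good_map_iff he hlt hinit hd c' l').2 h')
    · rw [hX, branchUnion_map he hlt hinit hd]
  · rintro ⟨c, l, hg, hmin, hX⟩
    refine ⟨c, l.map e, (good_map_iff he hlt hinit hd c l).2 hg, fun c' l' h' => ?_, fun k => ?_⟩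
    · obtain ⟨l', rfl⟩ := h'.exists_map hinit
      rw [before_map_iff he hlt]
      exact hmin c' _ ((good_map_iff he hlt hinit hd c' l').1 h')
    · rw [hX, branchUnion_map he hlt hinit hd]
  · exact fun h c l hg => h c _ ((good_map_iff he hlt hinit hd c l).2 hg)
  · intro h c l hg
    obtain ⟨l, rfl⟩ := hg.exists_map hinit
    exact h c l ((good_map_iff he hlt hinit hd c l).1 hg)

end Transfer

end Derivation

section Definability

variable (J : List (Bool × ℕ) → List ℕ → Prop) (Y : ℕ → ℕ → Prop)

theorem measurable_apply_comp {X : Type*} [MeasurableSpace X] {r : X → ℕ → ℕ → Prop}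
    (hr : ∀ a b, Measurable fun x => r x a b) {f g : X → ℕ} (hf : Measurable f)
    (hg : Measurable g) : Measurable fun x => r x (f x) (g x) := by
  have h : (fun x => r x (f x) (g x)) = fun x => ∀ a b, f x = a → g x = b → r x a b := by
    funext x
    simp
  rw [h]
  exact Measurable.forall fun a => Measurable.forall fun b =>
    (measurableSet_setOfPred.1 (hf (measurableSet_singleton a))).imp
      ((measurableSet_setOfPred.1 (hg (measurableSet_singleton b))).imp (hr a b))

theorem An.branchUnion (m : ℕ) (c : List (Bool × ℕ)) (l : List ℕ) (k : ℕ) :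
    An {y : (ℕ → ℕ → Prop) × (ℕ → ℕ → Prop) | BranchUnion J y.1 y.2 m c l k} := by
  obtain ⟨g, hg, hgs⟩ := exists_measurable_surjective ((ℕ → Bool × ℕ) × (ℕ → ℕ))
  have hS : MeasurableSet {p : ((ℕ → ℕ → Prop) × (ℕ → ℕ → Prop)) × ((ℕ → Bool × ℕ) × (ℕ → ℕ)) |
      Branch J p.1.1 p.1.2 m c l p.2.1 p.2.2 ∧ (p.2.1 k).1 = true} := by
    have hw : ∀ a b, Measurable fun p : ((ℕ → ℕ → Prop) × (ℕ → ℕ → Prop)) ×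
        ((ℕ → Bool × ℕ) × (ℕ → ℕ)) => p.1.1 a b := fun a b => by fun_prop
    have hd : ∀ a b, Measurable fun p : ((ℕ → ℕ → Prop) × (ℕ → ℕ → Prop)) ×
        ((ℕ → Bool × ℕ) × (ℕ → ℕ)) => p.1.2 a b := fun a b => by fun_prop
    have hu : ∀ i, Measurable fun p : ((ℕ → ℕ → Prop) × (ℕ → ℕ → Prop)) ×
        ((ℕ → Bool × ℕ) × (ℕ → ℕ)) => p.2.1 i := fun i => by fun_prop
    have hh : ∀ i, Measurable fun p : ((ℕ → ℕ → Prop) × (ℕ → ℕ → Prop)) ×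
        ((ℕ → Bool × ℕ) × (ℕ → ℕ)) => p.2.2 i := fun i => by fun_prop
    have hk : ∀ i, Measurable fun p : ((ℕ → ℕ → Prop) × (ℕ → ℕ → Prop)) ×
        ((ℕ → Bool × ℕ) × (ℕ → ℕ)) => (p.2.1 i).1 = true := fun i =>
      measurableSet_setOfPred.1 ((measurable_fst.comp (hu i)) (measurableSet_singleton true))
    refine measurableSet_setOfPred.2 (Measurable.and ?_ (hk k))
    simp only [branch_iff]
    refine Measurable.and ?_ (Measurable.and ?_ (Measurable.and ?_ (Measurable.and ?_ ?_)))
    · exact Measurable.forall fun i => Measurable.forall fun j =>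
        (measurable_treeRel hu _ _).imp (measurable_apply_comp hw (hh j) (hh i))
    · exact Measurable.forall fun i => measurable_apply_comp hw (hh i) measurable_const
    · exact measurable_seqRestrict_pred hu (fun c' => c' = c) _
    · exact measurable_seqRestrict_pred hh (fun l' => l' = l) _
    · refine Measurable.forall fun s => Measurable.imp
        (Measurable.forall fun i => measurable_const.imp (hw _ _))
        (Measurable.forall fun N => Measurable.exists fun k => measurable_const.and
          ((hk k).and (Measurable.forall fun i => measurable_const.imp (hd _ _))))
  convert (An.of_measurableSet hS).proj_of_surjective hg hgs using 1
  ext y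
  simp [BranchUnion, Prod.exists]

theorem Delta2.good (m : ℕ) (c : List (Bool × ℕ)) (l : List ℕ) :
    Delta2 fun y : (ℕ → ℕ → Prop) × (ℕ → ℕ → Prop) => Good J Y y.1 y.2 m c l := by
  have hw : ∀ a b, Delta2 fun p : (ℕ → ℕ → Prop) × (ℕ → ℕ → Prop) => p.1 a b :=
    fun a b => .of_measurable (by fun_prop)
  have hd : ∀ a b, Delta2 fun p : (ℕ → ℕ → Prop) × (ℕ → ℕ → Prop) => p.2 a b :=
    fun a b => .of_measurable (by fun_prop)
  have hc : ∀ q : Prop, Delta2 fun _ : (ℕ → ℕ → Prop) × (ℕ → ℕ → Prop) => q :=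
    fun q => .of_measurable measurable_const
  have hE : ∀ k, Delta2 fun y : (ℕ → ℕ → Prop) × (ℕ → ℕ → Prop) =>
    BranchUnion J y.1 y.2 m c l k := fun k => .of_an (.branchUnion J m c l k)
  exact (Delta2.ex hE).and (.all fun s => (Delta2.all fun i => (hc _).imp (hw _ _)).imp
    (.all fun N => .ex fun n => (hc _).and (.all fun M => .ex fun k => (hc _).and
      ((Delta2.and (.all fun i => (hc _).imp (hd _ _)) (hE k).not).and (hc _)))))

theorem Delta2.before (c c' : List (Bool × ℕ)) (l l' : List ℕ) :
    Delta2 fun y : (ℕ → ℕ → Prop) × (ℕ → ℕ → Prop) => Before y.1 (c', l') (c, l) := by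
  have hc : ∀ q : Prop, Delta2 fun _ : (ℕ → ℕ → Prop) × (ℕ → ℕ → Prop) => q :=
    fun q => .of_measurable measurable_const
  have hlex : ∀ l' l : List ℕ,
      Delta2 fun y : (ℕ → ℕ → Prop) × (ℕ → ℕ → Prop) => List.Lex y.1 l' l := by
    intro l'
    induction l' with
    | nil =>
      intro l
      cases l with
      | nil => simpa using hc False
      | cons b l => simpa using hc True
    | cons a l' ih =>
      intro l
      cases l with
      | nil => simpa using hc False
      | cons b l =>
        simp only [lex_cons_cons]
        exact Delta2.or (.of_measurable (by fun_prop)) ((hc _).and (ih l))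
  simp only [Before, InvImage, Prod.lex_def, List.shortlex_def]
  exact (hc _).or ((hc _).and ((hc _).or ((hc _).and (hlex _ _))))

theorem Delta2.isNext (m : ℕ) :
    Delta2 fun y : (ℕ → ℕ → Prop) × (ℕ → ℕ → Prop) => IsNext J Y y.1 y.2 m (y.2 m) := by
  have hd : ∀ a b, Delta2 fun p : (ℕ → ℕ → Prop) × (ℕ → ℕ → Prop) => p.2 a b :=
    fun a b => .of_measurable (by fun_prop)
  exact Delta2.or
    (.ex fun c => .ex fun l => (Delta2.good J Y m c l).and ((Delta2.all fun c' => .all fun l' =>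
      (Delta2.good J Y m c' l').imp (Delta2.before c c' l l').not).and
        (.all fun k => (hd _ _).iff (Delta2.of_an (.branchUnion J m c l k)).not)))
    (Delta2.and (.all fun c => .all fun l => (Delta2.good J Y m c l).not) (.all fun k => hd _ _))

theorem Delta2.wellFounded : Delta2 fun y : (ℕ → ℕ → Prop) × (ℕ → ℕ → Prop) =>
    WellFounded y.1 := by
  have h : Delta2 fun y : (ℕ → ℕ → Prop) × (ℕ → ℕ → Prop) =>
      ∃ f : ℕ → ℕ, ∀ n, y.1 (f (n + 1)) (f n) := by
    refine .of_an ⟨{p | ∀ n, p.1.1 (p.2 (n + 1)) (p.2 n)}, ?_, rfl⟩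
    refine measurableSet_setOfPred.2 (Measurable.forall fun n =>
      measurable_apply_comp 
        (r := fun (p : ((ℕ → ℕ → Prop) × (ℕ → ℕ → Prop)) × (ℕ → ℕ)) a b => p.1.1 a b)
        (fun a b => ?_) ?_ ?_) <;> fun_prop
  convert h.not using 2 with y
  rw [wellFounded_iff_isEmpty_descending_chain, isEmpty_subtype, not_exists]

end Definability

section Sequence

variable {J : List (Bool × ℕ) → List ℕ → Prop} {Y : ℕ → ℕ → Prop}

theorem isNext_congr {ι : Type*} {lt : ι → ι → Prop} {d d' : ι → ℕ → Prop} {m : ι}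
    (h : ∀ a, lt a m → d a = d' a) (X : ℕ → Prop) :
    IsNext J Y lt d' m X ↔ IsNext J Y lt d m X :=
  isNext_map_iff (e := id) Function.injective_id (fun _ _ => Iff.rfl) (fun _ k _ => ⟨k, rfl⟩) h X

variable (J Y) in
theorem exists_isNext_sequence :
    ∃ D : Ordinal.{0} → ℕ → Prop, ∀ β, IsNext J Y (· < ·) D β (D β) := by
  classical
  have hwf : WellFounded ((· < ·) : Ordinal.{0} → Ordinal.{0} → Prop) := wellFounded_lt
  let F : (β : Ordinal.{0}) → ((γ : Ordinal.{0}) → γ < β → ℕ → Prop) → ℕ → Prop := fun β f =>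
    (exists_isNext (J := J) (Y := Y) hwf (fun γ => if h : γ < β then f γ h else fun _ => True)
      β).choose
  refine ⟨hwf.fix F, fun β => ?_⟩
  have h1 := hwf.fix_eq F β
  rw [h1]
  refine (isNext_congr (fun γ hγ => ?_) _).1 (exists_isNext (J := J) (Y := Y) hwf _ β).choose_spec
  rw [dif_pos hγ]

variable {D : Ordinal.{0} → ℕ → Prop}

theorem eq_of_isNext (hD : ∀ β, IsNext J Y (· < ·) D β (D β)) {w d : ℕ → ℕ → Prop}
    (hwf : WellFounded w) (htot : ∀ a b, w a b ∨ a = b ∨ w b a)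
    (hd : ∀ m, IsNext J Y w d m (d m)) (m : ℕ) : d m = D (relRank w m) := by
  have hlt : ∀ a b, w a b ↔ relRank w a < relRank w b := by
    refine fun a b => ⟨relRank_lt_of_rel (hwf.apply b), fun h => ?_⟩
    rcases htot a b with h' | rfl | h'
    · exact h'
    · exact (lt_irrefl _ h).elim
    · exact (lt_asymm h (relRank_lt_of_rel (hwf.apply a) h')).elim
  have he : Function.Injective (relRank w) := by
    intro a b h
    rcases htot a b with h' | h' | h'
    · exact (h.not_lt ((hlt _ _).1 h')).elim
    · exact h'
    · exact (h.not_gt ((hlt _ _).1 h')).elim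
  have hinit : ∀ a k, k < relRank w a → ∃ b, relRank w b = k := by
    intro a
    induction a using hwf.induction with
    | _ a ih =>
      intro k hk
      obtain ⟨b, hb, hkb⟩ := exists_rel_of_lt_relRank (hwf.apply a) hk
      rcases hkb.eq_or_lt with h | h
      · exact ⟨b, h.symm⟩
      · exact ih b hb k h
  induction m using hwf.induction with
  | _ m ih => exact ((isNext_map_iff he hlt hinit ih _).2 (hd m)).unique (hD _)

open scoped Ordinal in
theorem countable_Iio_of_lt_omega_one {α : Ordinal.{0}} (h : α < ω₁) : (Iio α).Countable := by
  rw [← Cardinal.le_aleph0_iff_set_countable, Cardinal.mk_Iio_ordinal, Cardinal.lift_le_aleph0,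
    ← Cardinal.lt_aleph_one_iff]
  exact Cardinal.lt_omega_iff_card_lt.1 h

open scoped Ordinal in
theorem exists_code_of_lt_omega_one (hD : ∀ β, IsNext J Y (· < ·) D β (D β)) {β : Ordinal.{0}}
    (hβ : β < ω₁) : ∃ w d : ℕ → ℕ → Prop, WellFounded w ∧ (∀ a b, w a b ∨ a = b ∨ w b a) ∧
      (∀ m, IsNext J Y w d m (d m)) ∧ ∃ m, d m = D β := by
  have hω : (Iio (max (Order.succ β) ω)).Infinite := by
    refine infinite_of_injective_forall_mem (f := ((↑) : ℕ → Ordinal)) Nat.cast_injective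
      fun n => ?_
    exact (Ordinal.natCast_lt_omega0 n).trans_le (le_max_right _ _)
  have hc := countable_Iio_of_lt_omega_one (max_lt ((Cardinal.isSuccLimit_omega 1).succ_lt hβ)
    Ordinal.omega0_lt_omega_one)
  have := hω.to_subtype
  have := hc.to_subtype
  obtain ⟨e⟩ : Nonempty (ℕ ≃ Iio (max (Order.succ β) ω)) := by
    obtain ⟨_⟩ := nonempty_denumerable (Iio (max (Order.succ β) ω))
    exact ⟨(Denumerable.eqv _).symm⟩
  have he : Function.Injective fun n => (e n : Ordinal.{0}) :=
    Subtype.val_injective.comp e.injective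
  refine ⟨fun a b => (e a : Ordinal) < e b, fun m => D (e m),
    InvImage.wf (fun n => (e n : Ordinal)) wellFounded_lt, fun a b => ?_, fun m => ?_,
    e.symm ⟨β, lt_max_of_lt_left (Order.lt_succ β)⟩, by simp⟩
  · rw [← he.eq_iff]
    exact lt_trichotomy _ _
  · refine (isNext_map_iff he (fun _ _ => Iff.rfl) (fun a k hk => ?_) (fun _ _ => rfl) _).1 (hD _)
    exact ⟨e.symm ⟨k, hk.trans (e a).2⟩, by simp⟩

open scoped Ordinal in
/-- Under the perfect set property only countably many sets are chosen before stage `ω₁`. -/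
theorem countable_image_isNext_sequence (H : CoanalyticPSP)
    (hD : ∀ β, IsNext J Y (· < ·) D β (D β)) : (D '' Iio ω₁).Countable := by
  let T : Set ((ℕ → Prop) × ((ℕ → ℕ → Prop) × (ℕ → ℕ → Prop))) :=
    {p | (WellFounded p.2.1 ∧ (∀ a b, p.2.1 a b ∨ a = b ∨ p.2.1 b a) ∧
      ∀ m, IsNext J Y p.2.1 p.2.2 m (p.2.2 m)) ∧ ∃ m, ∀ k, p.2.2 m k ↔ p.1 k}
  have hT : Sigma2 T := by
    have h1 : Delta2 fun y : (ℕ → ℕ → Prop) × (ℕ → ℕ → Prop) =>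
        WellFounded y.1 ∧ (∀ a b, y.1 a b ∨ a = b ∨ y.1 b a) ∧
          ∀ m, IsNext J Y y.1 y.2 m (y.2 m) :=
      Delta2.wellFounded.and (.and (.all fun a => .all fun b => .or (.of_measurable (by fun_prop))
        (.or (.of_measurable measurable_const) (.of_measurable (by fun_prop))))
        (.all fun m => Delta2.isNext J Y m))
    have h2 : Delta2 fun p : (ℕ → Prop) × ((ℕ → ℕ → Prop) × (ℕ → ℕ → Prop)) =>
        ∃ m, ∀ k, p.2.2 m k ↔ p.1 k :=
      .ex fun m => .all fun k => .iff (.of_measurable (by fun_prop)) (.of_measurable (by fun_prop))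
    exact ((h1.comp measurable_snd).and h2).1
  refine (countable_proj_of_bounded H hT (w := fun y => y.1) (fun a b => by fun_prop)
    (fun x y h => h.1.1) fun α hα => ?_).mono ?_
  · refine ((countable_Iio_of_lt_omega_one hα).image D).mono ?_
    rintro x ⟨y, ⟨⟨h1, h2, h3⟩, m, hm⟩, hα'⟩
    refine ⟨_, hα' m, ?_⟩
    rw [← eq_of_isNext hD h1 h2 h3 m]
    exact funext fun k => propext (hm k)
  · rintro _ ⟨β, hβ, rfl⟩
    obtain ⟨w, d, h1, h2, h3, m, hm⟩ := exists_code_of_lt_omega_one hD hβ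
    exact ⟨(w, d), ⟨h1, h2, h3⟩, m, fun k => by simp [hm]⟩

end Sequence

section Splitting

variable {J : List (Bool × ℕ) → List ℕ → Prop} {Y : ℕ → ℕ → Prop} {ι : Type*}
  {lt : ι → ι → Prop} {d : ι → ℕ → Prop} {m : ι}

theorem Branch.restrict {c : List (Bool × ℕ)} {l : List ι} {u : ℕ → Bool × ℕ} {h : ℕ → ι}
    (hb : Branch J lt d m c l u h) (N : ℕ) :
    Branch J lt d m (seqRestrict u N) (seqRestrict h N) u h :=
  ⟨hb.ranked, hb.lt_top, by simp, by simp, hb.pos⟩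

theorem Branch.exists_not_bigPos {c : List (Bool × ℕ)} {l : List ι} {u : ℕ → Bool × ℕ}
    {h : ℕ → ι} (hb : Branch J lt d m c l u h) (hbad : ¬ Good J Y lt d m c l) :
    ∃ s : List ι, (∀ i ∈ s, lt i m) ∧
      ¬ BigPos Y fun k => MeetAll d s k ∧ ¬ BranchUnion J lt d m c l k := by
  obtain ⟨k, -, hk, -⟩ := hb.pos [] (by simp) 0
  by_contra! hcon
  exact hbad ⟨⟨k, u, h, hb, hk⟩, hcon⟩

theorem Branch.exists_common (hbad : ∀ c l, ¬ Good J Y lt d m c l)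
    (hbig : ∀ s : List ι, (∀ i ∈ s, lt i m) → BigPos Y (MeetAll d s))
    {c c' : List (Bool × ℕ)} {l l' : List ι} {u u' : ℕ → Bool × ℕ} {h h' : ℕ → ι}
    (hb : Branch J lt d m c l u h) (hb' : Branch J lt d m c' l' u' h') (N : ℕ) :
    ∃ (v v' : ℕ → Bool × ℕ) (g g' : ℕ → ι) (c₁ c₁' : List (Bool × ℕ)) (l₁ l₁' : List ι) (k : ℕ),
      Branch J lt d m c₁ l₁ v g ∧ Branch J lt d m c₁' l₁' v' g' ∧
      (∀ i < N, v i = u i ∧ g i = h i) ∧ (∀ i < N, v' i = u' i ∧ g' i = h' i) ∧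
      N ≤ k ∧ (v k).1 = true ∧ (v' k).1 = true := by
  obtain ⟨s, hs, hE⟩ := (hb.restrict N).exists_not_bigPos (hbad _ _)
  obtain ⟨s', hs', hE'⟩ := (hb'.restrict N).exists_not_bigPos (hbad _ _)
  have hss : ∀ i ∈ s ++ s', lt i m := fun i hi =>
    (List.mem_append.1 hi).elim (hs i) (hs' i)
  have h1 : BigPos Y fun k => (MeetAll d s k ∧
        ¬ BranchUnion J lt d m (seqRestrict u N) (seqRestrict h N) k) ∨
      ((MeetAll d s' k ∧ ¬ BranchUnion J lt d m (seqRestrict u' N) (seqRestrict h' N) k) ∨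
        (BranchUnion J lt d m (seqRestrict u N) (seqRestrict h N) k ∧
          BranchUnion J lt d m (seqRestrict u' N) (seqRestrict h' N) k)) := by
    refine (hbig _ hss).mono fun k hk => ?_
    have hk1 : MeetAll d s k := fun i hi => hk i (List.mem_append_left _ hi)
    have hk2 : MeetAll d s' k := fun i hi => hk i (List.mem_append_right _ hi)
    tauto
  obtain ⟨k, hNk, ⟨v, g, hv, hvk⟩, v', g', hv', hvk'⟩ :=
    ((h1.or.resolve_left hE).or.resolve_left hE').infOften N
  refine ⟨v, v', g, g', _, _, _, _, k, hv, hv', fun i hi => ⟨?_, ?_⟩, fun i hi => ⟨?_, ?_⟩,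
    hNk, hvk, hvk'⟩
  · exact (seqRestrict_eq_iff v u N).1 (by simpa using hv.fst) i hi
  · exact (seqRestrict_eq_iff g h N).1 (by simpa using hv.snd) i hi
  · exact (seqRestrict_eq_iff v' u' N).1 (by simpa using hv'.fst) i hi
  · exact (seqRestrict_eq_iff g' h' N).1 (by simpa using hv'.snd) i hi

theorem ranked_of_forall_agree {U : ℕ → Bool × ℕ} {G : ℕ → ι}
    (h : ∀ n, ∃ u g, Ranked J lt u g ∧ ∀ i < n, u i = U i ∧ g i = G i) : Ranked J lt U G := by
  intro i j hij
  obtain ⟨u, g, hr, ha⟩ := h (i + j + (Denumerable.ofNat (List ℕ) j).length + 1)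
  rw [← (ha i (by omega)).2, ← (ha j (by omega)).2]
  refine hr i j ((treeRel_congr fun k hk => (ha k ?_).1).2 hij)
  omega

/-- A limit of agreeing approximations. -/
theorem exists_limit_of_agree {β : Type*} {x : ℕ → ℕ → β} {N : ℕ → ℕ} (hN : StrictMono N)
    (hx : ∀ n, ∀ i < N n, x (n + 1) i = x n i) : ∃ X : ℕ → β, ∀ n, ∀ i < N n, x n i = X i := by
  have key : ∀ n k, ∀ i < N n, x (n + k) i = x n i := by
    intro n k i hi
    induction k with
    | zero => rfl
    | succ k ih =>
      rw [← ih, ← add_assoc]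
      exact hx _ i (hi.trans_le (hN.monotone (Nat.le_add_right n k)))
  refine ⟨fun i => x (i + 1) i, fun n i hi => ?_⟩
  have hi' : i < N (i + 1) := (Nat.lt_succ_self i).trans_le (hN.id_le (i + 1))
  exact (key n (i + 1) i hi).symm.trans (add_comm n (i + 1) ▸ key (i + 1) n i hi')

theorem Branch.exists_splitting (hbad : ∀ c l, ¬ Good J Y lt d m c l)
    (hbig : ∀ s : List ι, (∀ i ∈ s, lt i m) → BigPos Y (MeetAll d s))
    {c c' : List (Bool × ℕ)} {l l' : List ι} {u u' : ℕ → Bool × ℕ} {h h' : ℕ → ι}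
    (hb : Branch J lt d m c l u h) (hb' : Branch J lt d m c' l' u' h') (k : ℕ) :
    ∃ (v v' : ℕ → Bool × ℕ) (g g' : ℕ → ι), Ranked J lt v g ∧ Ranked J lt v' g' ∧
      v k = u k ∧ v' k = u' k ∧ InfOften fun k => (v k).1 = true ∧ (v' k).1 = true := by
  let St := {p : (((ℕ → Bool × ℕ) × (ℕ → Bool × ℕ)) × ((ℕ → ι) × (ℕ → ι))) × ℕ //
    (∃ c l, Branch J lt d m c l p.1.1.1 p.1.2.1) ∧ ∃ c l, Branch J lt d m c l p.1.1.2 p.1.2.2}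
  have hstep : ∀ p : St, ∃ q : St,
      (∀ i < p.1.2, q.1.1.1.1 i = p.1.1.1.1 i) ∧ (∀ i < p.1.2, q.1.1.1.2 i = p.1.1.1.2 i) ∧
      (∀ i < p.1.2, q.1.1.2.1 i = p.1.1.2.1 i) ∧ (∀ i < p.1.2, q.1.1.2.2 i = p.1.1.2.2 i) ∧
      ∃ k, p.1.2 ≤ k ∧ k < q.1.2 ∧ (q.1.1.1.1 k).1 = true ∧ (q.1.1.1.2 k).1 = true := by
    rintro ⟨⟨⟨⟨u, u'⟩, h, h'⟩, N⟩, ⟨c, l, hb⟩, c', l', hb'⟩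
    obtain ⟨v, v', g, g', c₁, c₁', l₁, l₁', k, hv, hv', ha, ha', hk, hvk, hvk'⟩ :=
      Branch.exists_common hbad hbig hb hb' N
    exact ⟨⟨⟨⟨⟨v, v'⟩, g, g'⟩, k + 1⟩, ⟨_, _, hv⟩, _, _, hv'⟩, fun i hi => (ha i hi).1,
      fun i hi => (ha' i hi).1, fun i hi => (ha i hi).2, fun i hi => (ha' i hi).2, k, hk,
      Nat.lt_succ_self k, hvk, hvk'⟩
  choose next h1 h2 h3 h4 h5 using hstep
  let p : ℕ → St := fun n => next^[n] ⟨⟨⟨⟨u, u'⟩, h, h'⟩, k + 1⟩, ⟨_, _, hb⟩, _, _, hb'⟩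
  have hp : ∀ n, p (n + 1) = next (p n) := fun n => Function.iterate_succ_apply' _ _ _
  have hN : StrictMono fun n => (p n).1.2 := by
    refine strictMono_nat_of_lt_succ fun n => ?_
    obtain ⟨k, hk, hk', -⟩ := h5 (p n)
    rw [hp]
    exact hk.trans_lt hk'
  obtain ⟨v, hv⟩ := exists_limit_of_agree (x := fun n => (p n).1.1.1.1) hN fun n i hi => by
    simp only [hp]
    exact h1 _ i hi
  obtain ⟨v', hv'⟩ := exists_limit_of_agree (x := fun n => (p n).1.1.1.2) hN fun n i hi => by
    simp only [hp]
    exact h2 _ i hi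
  obtain ⟨g, hg⟩ := exists_limit_of_agree (x := fun n => (p n).1.1.2.1) hN fun n i hi => by
    simp only [hp]
    exact h3 _ i hi
  obtain ⟨g', hg'⟩ := exists_limit_of_agree (x := fun n => (p n).1.1.2.2) hN fun n i hi => by
    simp only [hp]
    exact h4 _ i hi
  refine ⟨v, v', g, g', ranked_of_forall_agree fun n => ?_, ranked_of_forall_agree fun n => ?_,
    (hv 0 k (Nat.lt_succ_self k)).symm, (hv' 0 k (Nat.lt_succ_self k)).symm, fun n => ?_⟩
  · obtain ⟨c, l, hb⟩ := (p n).2.1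
    exact ⟨_, _, hb.ranked, fun i hi =>
      ⟨hv n i (hi.trans_le (hN.id_le n)), hg n i (hi.trans_le (hN.id_le n))⟩⟩
  · obtain ⟨c, l, hb⟩ := (p n).2.2
    exact ⟨_, _, hb.ranked, fun i hi =>
      ⟨hv' n i (hi.trans_le (hN.id_le n)), hg' n i (hi.trans_le (hN.id_le n))⟩⟩
  · obtain ⟨k, hk, hk', h6, h7⟩ := h5 (p n)
    rw [← hp] at hk' h6 h7
    exact ⟨k, (hN.id_le n).trans hk, hv (n + 1) k hk' ▸ h6, hv' (n + 1) k hk' ▸ h7⟩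

end Splitting

section Ordinals

variable {J : List (Bool × ℕ) → List ℕ → Prop} {Y : ℕ → ℕ → Prop}

theorem Ranked.acc {u : ℕ → Bool × ℕ} {h : ℕ → Ordinal.{0}} (hr : Ranked J (· < ·) u h) :
    Acc (treeRel J u) [] := by
  have hsub : Subrelation (treeRel J u)
      (InvImage (· < ·) fun σ : List ℕ => h (Encodable.encode σ)) := by
    intro τ σ hτ
    exact hr _ _ (by simpa using hτ)
  exact (hsub.wf (InvImage.wf _ wellFounded_lt)).apply []

open scoped Ordinal in
theorem exists_ranked {u : ℕ → Bool × ℕ} (h : Acc (treeRel J u) []) :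
    ∃ g : ℕ → Ordinal.{0}, Ranked J (· < ·) u g ∧ ∀ i, g i < ω₁ :=
  ⟨fun i => relRank (treeRel J u) (Denumerable.ofNat (List ℕ) i),
    fun _ _ hij => relRank_lt_of_rel (acc_treeRel h _) hij, fun _ => relRank_lt_omega_one _ _⟩

variable {D : Ordinal.{0} → ℕ → Prop}

theorem bigPos_meetAll (hD : ∀ β, IsNext J Y (· < ·) D β (D β)) (hY : BigPos Y fun _ => True)
    (s : List Ordinal.{0}) : BigPos Y (MeetAll D s) := by
  classical
  suffices h : ∀ s : Finset Ordinal.{0}, BigPos Y fun k => ∀ i ∈ s, D i k from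
    (h s.toFinset).mono fun k hk i hi => hk i (List.mem_toFinset.2 hi)
  intro s
  induction s using Finset.induction_on_max with
  | empty => exact hY.mono (by simp)
  | insert a s ha ih =>
    rcases hD a with ⟨c, l, hg, -, hX⟩ | ⟨-, hX⟩
    · refine (hg.2 s.toList fun i hi => ha i (Finset.mem_toList.1 hi)).mono fun k hk i hi => ?_
      rcases Finset.mem_insert.1 hi with rfl | hi
      · exact (hX k).2 hk.2
      · exact hk.1 i (Finset.mem_toList.2 hi)
    · refine ih.mono fun k hk i hi => ?_
      rcases Finset.mem_insert.1 hi with rfl | hi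
      · exact hX k
      · exact hk i hi

theorem ne_of_good (hD : ∀ β, IsNext J Y (· < ·) D β (D β)) {β γ : Ordinal.{0}} (hγ : γ < β)
    (hg : ∃ c l, Good J Y (· < ·) D β c l) : D γ ≠ D β := by
  rcases hD β with ⟨c, l, hg, -, hX⟩ | ⟨h, -⟩
  · obtain ⟨k, u, h, hb, hk⟩ := hg.1
    obtain ⟨n, -, hn, hn'⟩ := hb.pos [γ] (by simpa using hγ) 0
    intro heq
    have h1 : D γ n := hn' γ (by simp)
    rw [heq, hX] at h1
    exact h1 ⟨u, h, hb, hn⟩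
  · obtain ⟨c, l, hg⟩ := hg
    exact (h c l hg).elim

open scoped Ordinal in
theorem exists_bound_good (H : CoanalyticPSP) (hD : ∀ β, IsNext J Y (· < ·) D β (D β)) :
    ∃ α < ω₁, ∀ β, α ≤ β → β < ω₁ → ∀ c l, ¬ Good J Y (· < ·) D β c l := by
  have hc : {β | β < ω₁ ∧ ∃ c l, Good J Y (· < ·) D β c l}.Countable := by
    refine countable_of_injective_of_countable_image (f := D) ?_
      ((countable_image_isNext_sequence H hD).mono (image_mono fun β hβ => hβ.1))
    intro β hβ γ hγ heq
    rcases lt_trichotomy β γ with h | h | h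
    · exact (ne_of_good hD h hγ.2 heq).elim
    · exact h
    · exact (ne_of_good hD h hβ.2 heq.symm).elim
  have := hc.to_subtype
  refine ⟨⨆ β : {β | β < ω₁ ∧ ∃ c l, Good J Y (· < ·) D β c l}, Order.succ (β : Ordinal.{0}),
    ?_, ?_⟩
  · exact Ordinal.iSup_lt_omega_one fun β => (Cardinal.isSuccLimit_omega 1).succ_lt β.2.1
  · intro β hle hlt c l hg
    exact ((Order.lt_succ β).trans_le ((Ordinal.le_iSup (fun β : {β | β < ω₁ ∧
      ∃ c l, Good J Y (· < ·) D β c l} => Order.succ (β : Ordinal.{0}))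
      ⟨β, hlt, c, l, hg⟩).trans hle)).false

end Ordinals

theorem exists_pseudointersection {E : ℕ → ℕ → Prop}
    (h : ∀ n, InfOften fun k => ∀ i < n, E i k) :
    ∃ x : Set ℕ, x.Infinite ∧ ∀ n, {k ∈ x | ¬ E n k}.Finite := by
  choose f hf hE using fun n => h n n
  refine ⟨range f, infinite_of_not_bddAbove ?_, fun n => ?_⟩
  · rintro ⟨b, hb⟩
    exact absurd ((hf (b + 1)).trans (hb (mem_range_self (b + 1)))) (by omega)
  · refine ((finite_Iic n).image f).subset ?_
    rintro _ ⟨⟨m, rfl⟩, hm⟩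
    refine ⟨m, ?_, rfl⟩
    by_contra hmn
    exact hm (hE m n (by simpa using hmn))

open scoped Ordinal in
/-- An infinite almost disjoint family of infinite sets defined by well-foundedness of the trees
of `J` along codes is not maximal. -/
theorem exists_infinite_almostDisjoint (H : CoanalyticPSP) (J : List (Bool × ℕ) → List ℕ → Prop)
    {𝒜 : Set (Set ℕ)}
    (h𝒜 : ∀ A, A ∈ 𝒜 ↔ ∃ u : ℕ → Bool × ℕ, {k | (u k).1 = true} = A ∧ Acc (treeRel J u) [])
    (hinf : 𝒜.Infinite) (hmem : ∀ y ∈ 𝒜, y.Infinite)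
    (had : ∀ x ∈ 𝒜, ∀ y ∈ 𝒜, x = y ∨ (x ∩ y).Finite) :
    ∃ x : Set ℕ, x.Infinite ∧ ∀ y ∈ 𝒜, (x ∩ y).Finite := by
  let f := hinf.natEmbedding
  let Y : ℕ → ℕ → Prop := fun n k => k ∈ (f n : Set ℕ)
  have hY : BigPos Y fun _ => True := fun N => ⟨N, le_rfl, by
    simpa [Y, infOften_iff] using hmem _ (f N).2⟩
  have hsmall : ∀ y ∈ 𝒜, ¬ BigPos Y fun k => k ∈ y := by
    intro y hy hbig
    have heq : ∀ n, (InfOften fun k => k ∈ y ∧ Y n k) → (f n : Set ℕ) = y := by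
      intro n hn
      rw [infOften_iff] at hn
      exact (had y hy _ (f n).2).elim Eq.symm fun h => (hn h).elim
    obtain ⟨n, -, hn⟩ := hbig 0
    obtain ⟨n', hle, hn'⟩ := hbig (n + 1)
    have := f.injective (Subtype.ext ((heq n hn).trans (heq n' hn').symm))
    omega
  obtain ⟨D, hD⟩ := exists_isNext_sequence J Y
  have hbig := bigPos_meetAll hD hY
  obtain ⟨α₁, hα₁, hbad⟩ := exists_bound_good H hD
  obtain ⟨E, hE⟩ := (countable_image_isNext_sequence H hD).exists_eq_range
    ⟨_, ⟨0, Ordinal.omega_pos 1, rfl⟩⟩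
  choose b hb hbE using fun n => hE.superset (mem_range_self n)
  obtain ⟨x, hx, hxE⟩ := exists_pseudointersection (E := E) fun n =>
    (hbig ((List.range n).map b)).infOften.mono fun k hk i hi => by
      rw [← hbE]
      exact hk _ (List.mem_map_of_mem (List.mem_range.2 hi))
  refine ⟨x, hx, fun y hy => not_not.1 fun hxy => ?_⟩
  obtain ⟨u, rfl, hu⟩ := (h𝒜 y).1 hy
  obtain ⟨h, hr, hh⟩ := exists_ranked hu
  obtain ⟨α, hα₁α, hα, hhα⟩ : ∃ α, α₁ ≤ α ∧ α < ω₁ ∧ ∀ i, h i < α :=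
    ⟨max α₁ (⨆ i, Order.succ (h i)), le_max_left _ _, max_lt hα₁ (Ordinal.iSup_lt_omega_one fun i =>
      (Cardinal.isSuccLimit_omega 1).succ_lt (hh i)), fun i => lt_max_of_lt_right
        ((Order.lt_succ _).trans_le (Ordinal.le_iSup (fun i => Order.succ (h i)) i))⟩
  have hbr : Branch J (· < ·) D α [] [] u h := by
    refine ⟨hr, hhα, rfl, rfl, fun s hs => ?_⟩
    rw [infOften_iff]
    have hfin : (⋃ i ∈ {i | i ∈ s}, {k ∈ x | ¬ D i k}).Finite := by
      refine s.finite_toSet.biUnion fun i hi => ?_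
      obtain ⟨n, hn⟩ : D i ∈ range E := hE ▸ mem_image_of_mem D ((hs i hi).trans hα)
      rw [← hn]
      exact hxE n
    refine ((show (x ∩ {k | (u k).1 = true}).Infinite from hxy).sdiff hfin).mono fun k hk => ⟨hk.1.2, fun i hi => ?_⟩
    by_contra hDk
    exact hk.2 (mem_biUnion (x := i) hi ⟨hk.1.1, hDk⟩)
  by_cases hone : ∀ v g, Branch J (· < ·) D α [] [] v g → ∀ k, (v k).1 = (u k).1
  · obtain ⟨s, -, hs⟩ := hbr.exists_not_bigPos (hbad α hα₁α hα [] [])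
    refine hsmall _ hy ((((hbig s).mono fun k hk => ?_).or.resolve_left hs))
    by_cases hk' : BranchUnion J (· < ·) D α [] [] k
    · obtain ⟨v, g, hv, hvk⟩ := hk'
      exact Or.inr ((hone v g hv k).symm.trans hvk)
    · exact Or.inl ⟨hk, hk'⟩
  · push Not at hone
    obtain ⟨u', h', hbr', k, hk⟩ := hone
    obtain ⟨v, v', g, g', hv, hv', hvk, hvk', hinter⟩ :=
      Branch.exists_splitting (hbad α hα₁α hα) (fun s _ => hbig s) hbr hbr' k
    rcases had _ ((h𝒜 _).2 ⟨v, rfl, hv.acc⟩) _ ((h𝒜 _).2 ⟨v', rfl, hv'.acc⟩) with heq | hfin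
    · have h1 : (v k).1 = true ↔ (v' k).1 = true := Set.ext_iff.1 heq k
      rw [hvk, hvk'] at h1
      exact hk (Bool.eq_iff_iff.2 h1.symm)
    · exact infOften_iff.1 hinter hfin

theorem Sigma12In.exists_tree {a : ℕ → ℕ} {𝒜 : Set (Set ℕ)} (h : Sigma12In a 𝒜) :
    ∃ J : List (Bool × ℕ) → List ℕ → Prop, ∀ A, A ∈ 𝒜 ↔
      ∃ u : ℕ → Bool × ℕ, {k | (u k).1 = true} = A ∧ Acc (treeRel J u) [] := by
  obtain ⟨R, -, rfl⟩ := h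
  refine ⟨fun l τ => ¬ R (l.map Prod.fst, l.map Prod.snd, τ, seqRestrict a l.length) = true,
    fun A => ?_⟩
  simp only [acc_treeRel_nil_iff, not_not, ofFn_eq_seqRestrict, length_seqRestrict]
  constructor
  · rintro ⟨x, hx, y, hy⟩
    refine ⟨fun k => (x k, y k), hx, fun z => ?_⟩
    simpa [seqRestrict, Function.comp_def] using hy z
  · rintro ⟨u, hu, hz⟩
    refine ⟨fun k => (u k).1, hu, fun k => (u k).2, fun z => ?_⟩
    simpa [seqRestrict, Function.comp_def] using hz z

end

/-!
STATEMENT 18 (Theorem 1.3(2)): if `ℵ₁^{L[a]} < ℵ₁` for every real `a` (each instance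
expressed through its classical Solovay–Mansfield equivalent, the perfect set
property for `Π¹₁(a)` sets), then there are no infinite boldface `Σ¹₂` maximal
almost disjoint families (boldface `Σ¹₂` = `Σ¹₂(a)` for some real parameter `a`).
-/

theorem no_boldface_sigma12_mad_family
    (hsmall : ∀ a : ℕ → ℕ, Aleph1OfLaCountable a)
    (𝒜 : Set (Set ℕ)) (hS : ∃ a : ℕ → ℕ, Sigma12In a 𝒜)
    (hinf : 𝒜.Infinite) (hmem : ∀ y ∈ 𝒜, y.Infinite)
    (had : AlmostDisjointFam 𝒜) :
    ∃ x : Set ℕ, x.Infinite ∧ ∀ y ∈ 𝒜, (x ∩ y).Finite := by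
  obtain ⟨a, ha⟩ := hS
  obtain ⟨J, hJ⟩ := ha.exists_tree
  exact exists_infinite_almostDisjoint (coanalyticPSP_of_small hsmall) J hJ hinf hmem had
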